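/- arXiv:math/0305253 — 11 statements merged into one kernel-verified Lean document; each statement's English description precedes it below -/
import Mathlib

section
/- The double limit of (U_{m,n})^{1/(mn)} as m and n both tend to infinity exists and equals (1+√5)/2; that is, the function (m,n) ↦ (U_{m,n} : ℝ)^{1/(mn)} tends to (1+√5)/2 along the product filter atTop ×ˢ atTop on ℕ × ℕ. -/
/-- There exist indices `i, j` with `A (i+1, j) = A (i, j+1) = 1` (anti-diagonal pair). -/
def hasAnti (m n : ℕ) (A : Fin m × Fin n → Bool) : Prop :=
  ∃ i j, ∃ (hi : i + 1 < m) (hj : j + 1 < n),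
    A (⟨i + 1, hi⟩, ⟨j, by omega⟩) = true ∧ A (⟨i, by omega⟩, ⟨j + 1, hj⟩) = true

/-- `U m n`: the number of `m × n` binary matrices avoiding an anti-diagonal pair of 1's. -/
noncomputable def U (m n : ℕ) : ℕ :=
  Nat.card {A : Fin m × Fin n → Bool // ¬ hasAnti m n A}

/-- The subsets of `S` containing no two consecutive integers. -/
def sparseSubsets (S : Finset ℤ) : Finset (Finset ℤ) :=
  S.powerset.filter fun T => ∀ x ∈ T, x + 1 ∉ T

/-- The right ends of the maximal intervals of `S`. -/
def rightEnds (S : Finset ℤ) : Finset ℤ :=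
  S.filter fun x => x + 1 ∉ S

theorem mem_sparseSubsets {S T : Finset ℤ} :
    T ∈ sparseSubsets S ↔ T ⊆ S ∧ ∀ x ∈ T, x + 1 ∉ T := by
  simp [sparseSubsets]

theorem mem_rightEnds {S : Finset ℤ} {x : ℤ} : x ∈ rightEnds S ↔ x ∈ S ∧ x + 1 ∉ S := by
  simp [rightEnds]

theorem card_sparseSubsets_eq_add {S : Finset ℤ} {v : ℤ} (hv : v ∈ S) (hv1 : v + 1 ∉ S) :
    (sparseSubsets S).card = (sparseSubsets (S.erase v)).card +
      (sparseSubsets ((S.erase v).erase (v - 1))).card := by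
  rw [← Finset.card_filter_add_card_filter_not (fun T => v ∉ T)]
  congr 1
  · congr 1
    ext T
    simp only [Finset.mem_filter, mem_sparseSubsets, Finset.subset_erase]
    tauto
  · refine Finset.card_bij' (fun T _ => T.erase v) (fun T _ => insert v T) ?_ ?_ ?_ ?_
    · intro T hT
      simp only [Finset.mem_filter, mem_sparseSubsets, not_not] at hT ⊢
      obtain ⟨⟨hTS, hT⟩, hvT⟩ := hT
      refine ⟨fun x hx => ?_, fun x hx hx' =>
        hT x (Finset.mem_of_mem_erase hx) (Finset.mem_of_mem_erase hx')⟩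
      have hx' := Finset.mem_erase.1 hx
      refine Finset.mem_erase.2 ⟨?_, Finset.mem_erase.2 ⟨hx'.1, hTS hx'.2⟩⟩
      rintro rfl
      exact hT _ hx'.2 (by simpa using hvT)
    · intro T hT
      simp only [Finset.mem_filter, mem_sparseSubsets, not_not] at hT ⊢
      obtain ⟨hTS, hT⟩ := hT
      have hsub : ∀ x ∈ T, x ≠ v - 1 ∧ x ≠ v ∧ x ∈ S := fun x hx => by
        simpa using hTS hx
      refine ⟨⟨?_, ?_⟩, Finset.mem_insert_self _ _⟩
      · intro x hx
        rcases Finset.mem_insert.1 hx with rfl | hx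
        exacts [hv, (hsub x hx).2.2]
      · intro x hx hx1
        rcases Finset.mem_insert.1 hx with rfl | hx <;>
          rcases Finset.mem_insert.1 hx1 with h | hx1
        · omega
        · exact hv1 (hsub _ hx1).2.2
        · exact (hsub x hx).1 (by omega)
        · exact hT x hx hx1
    · intro T hT
      simp only [Finset.mem_filter, not_not] at hT
      exact Finset.insert_erase hT.2
    · intro T hT
      refine Finset.erase_insert fun h => ?_
      have := (mem_sparseSubsets.1 hT).1 h
      simp at this

theorem card_sparseSubsets_empty : (sparseSubsets ∅).card = 1 := by
  simp [sparseSubsets, Finset.filter_singleton]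

theorem card_rightEnds_erase_le {S : Finset ℤ} {v : ℤ} (hv1 : v + 1 ∉ S) :
    (rightEnds (S.erase v)).card ≤ (rightEnds S).card := by
  by_cases hv : v ∈ S
  · have hsub : rightEnds (S.erase v) ⊆ insert (v - 1) ((rightEnds S).erase v) := by
      intro x hx
      simp only [mem_rightEnds, Finset.mem_insert, Finset.mem_erase] at hx ⊢
      grind
    have hmem : v ∈ rightEnds S := mem_rightEnds.2 ⟨hv, hv1⟩
    calc _ ≤ _ := Finset.card_le_card hsub
      _ ≤ ((rightEnds S).erase v).card + 1 := Finset.card_insert_le _ _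
      _ = _ := Finset.card_erase_add_one hmem
  · rw [Finset.erase_eq_of_notMem hv]

theorem card_rightEnds_erase_add_one_le {S : Finset ℤ} {v : ℤ} (hv : v ∈ S) (hv1 : v + 1 ∉ S)
    (hw : v - 1 ∉ S) : (rightEnds (S.erase v)).card + 1 ≤ (rightEnds S).card := by
  have hsub : rightEnds (S.erase v) ⊆ (rightEnds S).erase v := by
    intro x hx
    simp only [mem_rightEnds, Finset.mem_erase] at hx ⊢
    grind
  have hmem : v ∈ rightEnds S := mem_rightEnds.2 ⟨hv, hv1⟩
  have := Finset.card_le_card hsub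
  have := Finset.card_erase_add_one hmem
  omega

theorem exists_mem_add_one_notMem {S : Finset ℤ} (hS : S.Nonempty) : ∃ v ∈ S, v + 1 ∉ S :=
  ⟨S.max' hS, S.max'_mem hS, fun h => by have := S.le_max' _ h; omega⟩

open Real in
theorem goldenRatio_pow_add_pow (k : ℕ) :
    goldenRatio ^ (k + 1) + goldenRatio ^ k = goldenRatio ^ (k + 2) := by
  have := goldenRatio_sq
  rw [pow_add _ k 2, this]
  ring

open Real in
theorem goldenRatio_pow_le_card_sparseSubsets (S : Finset ℤ) :
    goldenRatio ^ S.card ≤ ((sparseSubsets S).card : ℝ) := by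
  induction S using Finset.strongInduction with
  | H S ih =>
    rcases S.eq_empty_or_nonempty with rfl | hS
    · simp [card_sparseSubsets_empty]
    obtain ⟨v, hv, hv1⟩ := exists_mem_add_one_notMem hS
    have h1 := ih _ (Finset.erase_ssubset hv)
    have h2 := ih _ ((Finset.erase_subset (v - 1) _).trans_ssubset (Finset.erase_ssubset hv))
    have hc := Finset.card_erase_add_one hv
    have hc2 := Finset.pred_card_le_card_erase (s := S.erase v) (a := v - 1)
    rw [card_sparseSubsets_eq_add hv hv1]
    push_cast
    refine le_trans ?_ (add_le_add h1 h2)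
    rw [← hc]
    rcases h : (S.erase v).card with _ | k
    · have := one_le_pow₀ one_lt_goldenRatio.le (n := ((S.erase v).erase (v - 1)).card)
      have := goldenRatio_lt_two
      norm_num
      linarith
    · rw [← goldenRatio_pow_add_pow]
      gcongr
      · exact one_lt_goldenRatio.le
      · omega

open Real in
theorem card_sparseSubsets_le_goldenRatio_pow (S : Finset ℤ) :
    ((sparseSubsets S).card : ℝ) ≤ goldenRatio ^ (S.card + (rightEnds S).card) := by
  induction S using Finset.strongInduction with
  | H S ih =>
    rcases S.eq_empty_or_nonempty with rfl | hS
    · simp [card_sparseSubsets_empty, rightEnds]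
    obtain ⟨v, hv, hv1⟩ := exists_mem_add_one_notMem hS
    have h1 := ih _ (Finset.erase_ssubset hv)
    have h2 := ih _ ((Finset.erase_subset (v - 1) _).trans_ssubset (Finset.erase_ssubset hv))
    have hc := Finset.card_erase_add_one hv
    have he := card_rightEnds_erase_le hv1
    have hpos : 0 < (rightEnds S).card :=
      Finset.card_pos.2 ⟨v, mem_rightEnds.2 ⟨hv, hv1⟩⟩
    have he2 : ((S.erase v).erase (v - 1)).card + (rightEnds ((S.erase v).erase (v - 1))).card + 2
        ≤ S.card + (rightEnds S).card := by
      by_cases hw : v - 1 ∈ S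
      · have hw' : v - 1 ∈ S.erase v := Finset.mem_erase.2 ⟨by omega, hw⟩
        have := Finset.card_erase_add_one hw'
        have := card_rightEnds_erase_le (S := S.erase v) (v := v - 1) (by simp)
        omega
      · have hw' : v - 1 ∉ S.erase v := fun h => hw (Finset.mem_of_mem_erase h)
        have := card_rightEnds_erase_add_one_le hv hv1 hw
        rw [Finset.erase_eq_of_notMem hw']
        omega
    rw [card_sparseSubsets_eq_add hv hv1]
    push_cast
    obtain ⟨k, hk⟩ : ∃ k, S.card + (rightEnds S).card = k + 2 :=
      ⟨S.card + (rightEnds S).card - 2, by omega⟩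
    rw [hk, ← goldenRatio_pow_add_pow]
    refine (add_le_add h1 h2).trans ?_
    exact add_le_add (pow_le_pow_right₀ one_lt_goldenRatio.le (by omega))
      (pow_le_pow_right₀ one_lt_goldenRatio.le (by omega))

/-- An enumeration of the cells in which antidiagonal neighbours become consecutive integers,
and different antidiagonals are separated by gaps. -/
def cellCode (m n : ℕ) (p : Fin m × Fin n) : ℤ :=
  (((p.1 + p.2) * (m + 1) + p.1 : ℕ) : ℤ)

theorem Nat.mul_add_inj_of_lt {a b r s M : ℕ} (hr : r < M) (hs : s < M)
    (h : a * M + r = b * M + s) : a = b ∧ r = s := by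
  have hM : 0 < M := by omega
  have hab : a = b := by
    simpa [Nat.add_comm (_ * M), Nat.add_mul_div_right _ _ hM,
      Nat.div_eq_of_lt hr, Nat.div_eq_of_lt hs] using congrArg (· / M) h
  subst hab
  exact ⟨rfl, by omega⟩

theorem cellCode_injective (m n : ℕ) : Function.Injective (cellCode m n) := by
  rintro ⟨i, j⟩ ⟨k, l⟩ h
  have h' := Nat.mul_add_inj_of_lt (by omega) (by omega) (Int.ofNat.inj h)
  simp only [Prod.mk.injEq, Fin.ext_iff] at h' ⊢
  omega

theorem cellCode_add_one_eq_iff {m n : ℕ} (p q : Fin m × Fin n) :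
    cellCode m n p + 1 = cellCode m n q ↔
      (q.1 : ℕ) = p.1 + 1 ∧ (p.2 : ℕ) = q.2 + 1 := by
  obtain ⟨i, j⟩ := p
  obtain ⟨k, l⟩ := q
  constructor
  · intro h
    have h' := Nat.mul_add_inj_of_lt (a := i + j) (b := k + l) (r := i + 1) (s := k) (M := m + 1)
      (by omega) (by omega) (by unfold cellCode at h; exact_mod_cast h)
    dsimp only
    omega
  · rintro ⟨h1, h2⟩
    dsimp only at h1 h2
    simp only [cellCode, h1, h2]
    push_cast
    ring

theorem hasAnti_iff {m n : ℕ} {A : Fin m × Fin n → Bool} :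
    hasAnti m n A ↔
      ∃ p q, A p = true ∧ A q = true ∧ cellCode m n p + 1 = cellCode m n q := by
  simp only [cellCode_add_one_eq_iff]
  constructor
  · rintro ⟨i, j, hi, hj, h1, h2⟩
    exact ⟨_, _, h2, h1, rfl, rfl⟩
  · rintro ⟨⟨⟨i, hi⟩, ⟨j, hj⟩⟩, ⟨⟨k, hk⟩, ⟨l, hl⟩⟩, h2, h1, hik, hjl⟩
    dsimp only at hik hjl
    subst hik hjl
    exact ⟨i, l, hk, hj, h1, h2⟩

/-- The set of codes of all cells of an `m × n` matrix. -/
def cellCodes (m n : ℕ) : Finset ℤ :=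
  Finset.univ.image (cellCode m n)

theorem card_cellCodes (m n : ℕ) : (cellCodes m n).card = m * n := by
  simp [cellCodes, Finset.card_image_of_injective _ (cellCode_injective m n)]

theorem U_eq_card_sparseSubsets (m n : ℕ) : U m n = (sparseSubsets (cellCodes m n)).card := by
  classical
  rw [U, Nat.card_eq_fintype_card, Fintype.card_subtype]
  refine Finset.card_bij'
    (fun A _ => (Finset.univ.filter fun p => A p = true).image (cellCode m n))
    (fun T _ p => decide (cellCode m n p ∈ T)) ?_ ?_ ?_ ?_
  · intro A hA
    rw [Finset.mem_filter, hasAnti_iff] at hA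
    refine mem_sparseSubsets.2 ⟨Finset.image_subset_image (Finset.filter_subset _ _), ?_⟩
    intro x hx hx1
    obtain ⟨p, hp, rfl⟩ := Finset.mem_image.1 hx
    obtain ⟨q, hq, hpq⟩ := Finset.mem_image.1 hx1
    exact hA.2 ⟨p, q, (Finset.mem_filter.1 hp).2, (Finset.mem_filter.1 hq).2, hpq.symm⟩
  · intro T hT
    rw [Finset.mem_filter, hasAnti_iff]
    refine ⟨Finset.mem_univ _, ?_⟩
    rintro ⟨p, q, hp, hq, hpq⟩
    exact (mem_sparseSubsets.1 hT).2 _ (of_decide_eq_true hp) (hpq ▸ of_decide_eq_true hq)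
  · intro A _
    funext p
    simp [(cellCode_injective m n).eq_iff]
  · intro T hT
    ext x
    simp only [Finset.mem_image, Finset.mem_filter, Finset.mem_univ, true_and, decide_eq_true_eq]
    constructor
    · rintro ⟨p, hp, rfl⟩
      exact hp
    · intro hx
      obtain ⟨p, -, rfl⟩ := Finset.mem_image.1 ((mem_sparseSubsets.1 hT).1 hx)
      exact ⟨p, hx, rfl⟩

theorem card_rightEnds_cellCodes_le (m n : ℕ) :
    (rightEnds (cellCodes m n)).card ≤ m + n := by
  have hsub : rightEnds (cellCodes m n) ⊆
      (Finset.range m).image (fun i : ℕ => ((i * (m + 1) + i : ℕ) : ℤ)) ∪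
      (Finset.range n).image (fun j : ℕ => (((m - 1 + j) * (m + 1) + (m - 1) : ℕ) : ℤ)) := by
    intro x hx
    obtain ⟨hx, hx1⟩ := mem_rightEnds.1 hx
    obtain ⟨⟨⟨i, hi⟩, ⟨j, hj⟩⟩, -, rfl⟩ := Finset.mem_image.1 hx
    simp only [Finset.mem_union, Finset.mem_image, Finset.mem_range]
    rcases Nat.eq_zero_or_pos j with rfl | hj0
    · exact Or.inl ⟨i, hi, rfl⟩
    · refine Or.inr ⟨j, hj, ?_⟩
      have him : i = m - 1 := by
        by_contra hne
        refine hx1 (Finset.mem_image.2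
          ⟨(⟨i + 1, by omega⟩, ⟨j - 1, by omega⟩), Finset.mem_univ _, ?_⟩)
        refine ((cellCode_add_one_eq_iff _ _).2 ⟨rfl, ?_⟩).symm
        dsimp only
        omega
      subst him
      rfl
  refine (Finset.card_le_card hsub).trans ((Finset.card_union_le _ _).trans ?_)
  refine add_le_add ?_ ?_ <;> exact Finset.card_image_le.trans (Finset.card_range _).le

open Real in
theorem goldenRatio_pow_le_U (m n : ℕ) : goldenRatio ^ (m * n) ≤ (U m n : ℝ) := by
  rw [U_eq_card_sparseSubsets, ← card_cellCodes]
  exact goldenRatio_pow_le_card_sparseSubsets _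

open Real in
theorem U_le_goldenRatio_pow (m n : ℕ) : (U m n : ℝ) ≤ goldenRatio ^ (m * n + (m + n)) := by
  rw [U_eq_card_sparseSubsets]
  refine (card_sparseSubsets_le_goldenRatio_pow _).trans ?_
  rw [card_cellCodes]
  gcongr
  · exact one_lt_goldenRatio.le
  · exact card_rightEnds_cellCodes_le m n

open Filter in
theorem U_root_tendsto :
    Tendsto (fun p : ℕ × ℕ => (U p.1 p.2 : ℝ) ^ (1 / ((p.1 : ℝ) * (p.2 : ℝ))))
      (atTop ×ˢ atTop) (nhds ((1 + Real.sqrt 5) / 2)) := by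
  change Tendsto _ _ (nhds Real.goldenRatio)
  have hpos : ∀ᶠ p : ℕ × ℕ in atTop ×ˢ atTop, 0 < p.1 ∧ 0 < p.2 :=
    (eventually_gt_atTop 0).prod_mk (eventually_gt_atTop 0)
  have hupper : Tendsto (fun p : ℕ × ℕ => Real.goldenRatio ^ (1 + 1 / (p.2 : ℝ) + 1 / (p.1 : ℝ)))
      (atTop ×ˢ atTop) (nhds Real.goldenRatio) := by
    have h1 : Tendsto (fun p : ℕ × ℕ => 1 + 1 / (p.2 : ℝ) + 1 / (p.1 : ℝ))
        (atTop ×ˢ atTop) (nhds (1 + 0 + 0)) :=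
      (tendsto_const_nhds.add (tendsto_one_div_atTop_nhds_zero_nat.comp tendsto_snd)).add
        (tendsto_one_div_atTop_nhds_zero_nat.comp tendsto_fst)
    have h2 := tendsto_const_nhds.rpow h1 (Or.inl Real.goldenRatio_ne_zero)
    simpa using h2
  refine tendsto_of_tendsto_of_tendsto_of_le_of_le' tendsto_const_nhds hupper ?_ ?_
  · filter_upwards [hpos] with p ⟨h1, h2⟩
    have h1' : (0 : ℝ) < p.1 := by exact_mod_cast h1
    have h2' : (0 : ℝ) < p.2 := by exact_mod_cast h2
    calc Real.goldenRatio
        = (Real.goldenRatio ^ (p.1 * p.2)) ^ (1 / ((p.1 : ℝ) * (p.2 : ℝ))) := by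
          rw [← Real.rpow_natCast, ← Real.rpow_mul Real.goldenRatio_pos.le]
          push_cast
          rw [mul_one_div_cancel (by positivity), Real.rpow_one]
      _ ≤ _ := Real.rpow_le_rpow (pow_nonneg Real.goldenRatio_pos.le _)
          (goldenRatio_pow_le_U _ _) (by positivity)
  · filter_upwards [hpos] with p ⟨h1, h2⟩
    have h1' : (0 : ℝ) < p.1 := by exact_mod_cast h1
    have h2' : (0 : ℝ) < p.2 := by exact_mod_cast h2
    calc _ ≤ (Real.goldenRatio ^ (p.1 * p.2 + (p.1 + p.2))) ^ (1 / ((p.1 : ℝ) * (p.2 : ℝ))) :=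
          Real.rpow_le_rpow (Nat.cast_nonneg _) (U_le_goldenRatio_pow _ _) (by positivity)
      _ = _ := by
          rw [← Real.rpow_natCast, ← Real.rpow_mul Real.goldenRatio_pos.le]
          push_cast
          congr 1
          field_simp
          ring
end

section
/- The double limit of (M_{m,n})^{1/(mn)} as m and n both tend to infinity exists; that is, there is a real number L such that the function (m,n) ↦ (M_{m,n} : ℝ)^{1/(mn)} tends to L along the product filter atTop ×ˢ atTop on ℕ × ℕ. -/
/-- There exist indices `i, j` with `A (i, j) = A (i+1, j+1) = 1` (main-diagonal pair). -/
def hasMain (m n : ℕ) (A : Fin m × Fin n → Bool) : Prop :=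
  ∃ i j, ∃ (hi : i + 1 < m) (hj : j + 1 < n),
    A (⟨i, by omega⟩, ⟨j, by omega⟩) = true ∧ A (⟨i + 1, hi⟩, ⟨j + 1, hj⟩) = true

/-- `M m n`: the number of `m × n` binary matrices with no two 1's diagonally adjacent,
i.e. the number of placements of mutually nonattacking pawns on an `m × n` board. -/
noncomputable def M (m n : ℕ) : ℕ :=
  Nat.card {A : Fin m × Fin n → Bool // ¬ hasAnti m n A ∧ ¬ hasMain m n A}

lemma M_pos (m n : ℕ) : 0 < M m n := by
  unfold M
  rw [Nat.card_pos_iff]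
  exact ⟨⟨⟨fun _ => false, by simp [hasAnti], by simp [hasMain]⟩⟩, inferInstance⟩

lemma M_le_two_pow (m n : ℕ) : M m n ≤ 2 ^ (m * n) := by
  unfold M
  refine (Nat.card_le_card_of_injective _ Subtype.val_injective).trans ?_
  simp

/-- Restricting a matrix to its first `a` rows and its last `b` rows keeps it admissible. -/
lemma M_add_left_le (a b n : ℕ) : M (a + b) n ≤ M a n * M b n := by
  unfold M
  rw [← Nat.card_prod]
  refine Nat.card_le_card_of_injective (fun A => (⟨fun p => A.1 (Fin.castAdd b p.1, p.2), ?_, ?_⟩,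
    ⟨fun p => A.1 (Fin.natAdd a p.1, p.2), ?_, ?_⟩)) ?_
  · rintro ⟨i, j, hi, hj, h⟩
    exact A.2.1 ⟨i, j, by omega, hj, h⟩
  · rintro ⟨i, j, hi, hj, h⟩
    exact A.2.2 ⟨i, j, by omega, hj, h⟩
  · rintro ⟨i, j, hi, hj, h⟩
    exact A.2.1 ⟨a + i, j, by omega, hj, h⟩
  · rintro ⟨i, j, hi, hj, h⟩
    exact A.2.2 ⟨a + i, j, by omega, hj, h⟩
  · intro A B h
    simp only [Prod.mk.injEq, Subtype.mk.injEq, funext_iff, Prod.forall] at h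
    ext ⟨i, j⟩ : 2
    exact Fin.addCases (fun i => h.1 i j) (fun i => h.2 i j) i

lemma M_le_M_swap (m n : ℕ) : M m n ≤ M n m := by
  unfold M
  refine Nat.card_le_card_of_injective (fun A => ⟨fun p => A.1 p.swap, ?_, ?_⟩) ?_
  · rintro ⟨i, j, hi, hj, h⟩
    exact A.2.1 ⟨j, i, hj, hi, h.2, h.1⟩
  · rintro ⟨i, j, hi, hj, h⟩
    exact A.2.2 ⟨j, i, hj, hi, h⟩
  · intro A B h
    simp only [Subtype.mk.injEq, funext_iff, Prod.forall, Prod.swap_prod_mk] at h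
    ext ⟨i, j⟩ : 2
    exact h j i

lemma M_comm (m n : ℕ) : M m n = M n m :=
  (M_le_M_swap m n).antisymm (M_le_M_swap n m)

lemma subadditive_log_M (n : ℕ) : Subadditive fun m => Real.log (M m n) := by
  intro a b
  have ha : (M a n : ℝ) ≠ 0 := by exact_mod_cast (M_pos a n).ne'
  have hb : (M b n : ℝ) ≠ 0 := by exact_mod_cast (M_pos b n).ne'
  rw [← Real.log_mul ha hb]
  exact Real.log_le_log (by exact_mod_cast M_pos _ n) (by exact_mod_cast M_add_left_le a b n)

lemma log_M_le (m n : ℕ) : Real.log (M m n) ≤ Real.log 2 * (m * n) := by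
  calc Real.log (M m n) ≤ Real.log (2 ^ (m * n)) :=
        Real.log_le_log (by exact_mod_cast M_pos m n) (by exact_mod_cast M_le_two_pow m n)
    _ = Real.log 2 * (m * n) := by rw [Real.log_pow]; push_cast; ring

/-- A nonnegative subadditive sequence of at most linear growth is bounded, up to a constant,
by the line through any of its values. -/
lemma Subadditive.le_div_mul_add {u : ℕ → ℝ} (hu : Subadditive u) (h0 : ∀ n, 0 ≤ u n) {C : ℝ}
    (hC : ∀ n, u n ≤ C * n) {k : ℕ} (hk : 0 < k) (n : ℕ) :
    u n ≤ n / k * u k + C * k := by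
  have hC0 : 0 ≤ C := by simpa using (h0 1).trans (hC 1)
  calc u n = u (n / k * k + n % k) := by rw [Nat.div_add_mod']
    _ ≤ (n / k : ℕ) * u k + u (n % k) := hu.apply_mul_add_le _ _ _
    _ ≤ n / k * u k + C * k := by
        refine add_le_add (mul_le_mul_of_nonneg_right Nat.cast_div_le (h0 k))
          ((hC _).trans (mul_le_mul_of_nonneg_left ?_ hC0))
        exact_mod_cast (Nat.mod_lt n hk).le

open Filter in
/-- Fekete's lemma in two variables. -/
lemma tendsto_div_mul_of_subadditive {u : ℕ → ℕ → ℝ} (hl : ∀ n, Subadditive fun m => u m n)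
    (hr : ∀ m, Subadditive (u m)) (h0 : ∀ m n, 0 ≤ u m n) {C : ℝ}
    (hC : ∀ m n, u m n ≤ C * (m * n)) :
    ∃ L : ℝ, Tendsto (fun p : ℕ × ℕ => u p.1 p.2 / ((p.1 : ℝ) * p.2))
      (atTop ×ˢ atTop) (nhds L) := by
  have key : ∀ {a b m n : ℕ}, 0 < a → 0 < b → 0 < m → 0 < n →
      u m n / ((m : ℝ) * n) ≤ u a b / ((a : ℝ) * b) + (C * b / n + C * a / m) := by
    intro a b m n ha hb hm hn
    have h1 := (hl n).le_div_mul_add (h0 · n) (C := C * n)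
      (fun i => (hC i n).trans_eq (by ring)) ha m
    have h2 := (hr a).le_div_mul_add (h0 a) (C := C * a)
      (fun i => (hC a i).trans_eq (by ring)) hb n
    have ha' : (0 : ℝ) < a := by exact_mod_cast ha
    have hb' : (0 : ℝ) < b := by exact_mod_cast hb
    have hm' : (0 : ℝ) < m := by exact_mod_cast hm
    have hn' : (0 : ℝ) < n := by exact_mod_cast hn
    rw [div_le_iff₀ (by positivity)]
    calc u m n ≤ m / a * u a n + C * n * a := h1
      _ ≤ m / a * (n / b * u a b + C * a * b) + C * n * a := by gcongr
      _ = _ := by field_simp; ring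
  set S : Set ℝ := (fun p : ℕ × ℕ => u p.1 p.2 / ((p.1 : ℝ) * p.2)) '' {p | 0 < p.1 ∧ 0 < p.2}
  have hS : BddBelow S :=
    ⟨0, by rintro _ ⟨p, -, rfl⟩; exact div_nonneg (h0 _ _) (by positivity)⟩
  have hne : S.Nonempty := ⟨_, (1, 1), ⟨one_pos, one_pos⟩, rfl⟩
  have hpos : ∀ᶠ p : ℕ × ℕ in atTop ×ˢ atTop, 0 < p.1 ∧ 0 < p.2 :=
    (eventually_gt_atTop 0).prod_mk (eventually_gt_atTop 0)
  refine ⟨sInf S, tendsto_order.2 ⟨fun x hx => ?_, fun x hx => ?_⟩⟩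
  · filter_upwards [hpos] with p hp
    exact hx.trans_le (csInf_le hS ⟨p, hp, rfl⟩)
  · obtain ⟨_, ⟨⟨a, b⟩, ⟨ha, hb⟩, rfl⟩, hab⟩ := exists_lt_of_csInf_lt hne hx
    have hlim : Tendsto (fun p : ℕ × ℕ => u a b / ((a : ℝ) * b) + (C * b / p.2 + C * a / p.1))
        (atTop ×ˢ atTop) (nhds (u a b / ((a : ℝ) * b) + (0 + 0))) :=
      tendsto_const_nhds.add
        (((tendsto_const_div_atTop_nhds_zero_nat _).comp tendsto_snd).add
          ((tendsto_const_div_atTop_nhds_zero_nat _).comp tendsto_fst))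
    filter_upwards [hpos, hlim.eventually_lt_const (by simpa using hab)] with p hp hlt
    exact (key ha hb hp.1 hp.2).trans_lt hlt

open Filter in
theorem M_root_tendsto_exists :
    ∃ L : ℝ, Tendsto (fun p : ℕ × ℕ => (M p.1 p.2 : ℝ) ^ (1 / ((p.1 : ℝ) * (p.2 : ℝ))))
      (atTop ×ˢ atTop) (nhds L) := by
  obtain ⟨L, hL⟩ := tendsto_div_mul_of_subadditive (u := fun m n => Real.log (M m n))
    subadditive_log_M (fun m => by simpa only [M_comm m] using subadditive_log_M m)
    (fun m n => Real.log_natCast_nonneg _) log_M_le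
  refine ⟨Real.exp L, ((Real.continuous_exp.tendsto L).comp hL).congr fun p => ?_⟩
  rw [Real.rpow_def_of_pos (by exact_mod_cast M_pos p.1 p.2), mul_one_div, Function.comp_apply]
end

section
/- If L is the real number such that (m,n) ↦ (M_{m,n} : ℝ)^{1/(mn)} tends to L along the product filter atTop ×ˢ atTop on ℕ × ℕ, then L ≤ (1+√5)/2. -/
/-- Binary words of length `n` with no two consecutive `true` entries. -/
def SparseWord (n : ℕ) : Type :=
  {B : Fin n → Bool // ∀ j (hj : j + 1 < n), ¬ (B ⟨j, by omega⟩ = true ∧ B ⟨j + 1, hj⟩ = true)}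

instance (n : ℕ) : Finite (SparseWord n) := by
  unfold SparseWord; infer_instance

namespace SparseWord

/-- The word obtained by deleting the first letter. -/
def tail {n : ℕ} (B : SparseWord (n + 1)) : SparseWord n :=
  ⟨fun j => B.1 j.succ, fun j hj => B.2 (j + 1) (by omega)⟩

theorem ext_of_tail {n : ℕ} {B C : SparseWord (n + 1)} (h0 : B.1 0 = C.1 0)
    (h : B.tail = C.tail) : B = C := by
  refine Subtype.ext (funext fun j => ?_)
  refine Fin.cases h0 (fun i => ?_) j
  exact congrFun (congrArg Subtype.val h) i

theorem tail_head_eq_false {n : ℕ} {B : SparseWord (n + 2)} (h : B.1 0 = true) :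
    B.tail.1 0 = false := by
  have := B.2 0 (by omega)
  by_contra h1
  exact this ⟨h, Bool.eq_true_of_not_eq_false h1⟩

theorem card_add_two_le (n : ℕ) :
    Nat.card (SparseWord (n + 2)) ≤ Nat.card (SparseWord (n + 1)) + Nat.card (SparseWord n) := by
  rw [← Nat.card_sum]
  refine Nat.card_le_card_of_injective
    (fun B => if B.1 0 = true then Sum.inr B.tail.tail else Sum.inl B.tail) ?_
  intro B C h
  by_cases hB : B.1 0 = true <;> by_cases hC : C.1 0 = true
  · simp only [hB, hC, if_true, Sum.inr.injEq] at h
    exact ext_of_tail (hB.trans hC.symm)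
      (ext_of_tail ((tail_head_eq_false hB).trans (tail_head_eq_false hC).symm) h)
  · simp [hB, hC] at h
  · simp [hB, hC] at h
  · simp only [hB, hC] at h
    exact ext_of_tail (by simp_all) (Sum.inl.inj h)

theorem card_le_fib (n : ℕ) : Nat.card (SparseWord n) ≤ Nat.fib (n + 2) := by
  induction n using Nat.twoStepInduction with
  | zero =>
    have : Nat.card (SparseWord 0) ≤ Nat.card (Fin 0 → Bool) :=
      Nat.card_le_card_of_injective _ Subtype.val_injective
    simpa using this
  | one =>
    have : Nat.card (SparseWord 1) ≤ Nat.card (Fin 1 → Bool) :=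
      Nat.card_le_card_of_injective _ Subtype.val_injective
    simpa [Nat.fib] using this
  | more n h0 h1 =>
    have := card_add_two_le n
    have hf : Nat.fib (n + 2 + 2) = Nat.fib (n + 2) + Nat.fib (n + 2 + 1) := Nat.fib_add_two
    have : n + 1 + 2 = n + 2 + 1 := by omega
    rw [this] at h1
    omega

end SparseWord

theorem fib_le_goldenRatio_pow (n : ℕ) : (Nat.fib (n + 1) : ℝ) ≤ Real.goldenRatio ^ n := by
  induction n using Nat.twoStepInduction with
  | zero => simp
  | one => simpa using Real.one_lt_goldenRatio.le
  | more n h0 h1 =>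
    rw [show n + 2 + 1 = (n + 1) + 2 from rfl, Nat.fib_add_two, pow_add, Real.goldenRatio_sq]
    push_cast
    rw [pow_succ] at h1
    linarith

/-- The row visited in column `j` by the zigzag that starts in row `r` and alternates between
the rows `2 * (r / 2)` and `2 * (r / 2) + 1`. -/
def zigzagRow {k : ℕ} (r : Fin (2 * k)) (j : ℕ) : Fin (2 * k) :=
  ⟨2 * (r / 2) + (r + j) % 2, by omega⟩

theorem zigzagRow_zigzagRow {k : ℕ} (r : Fin (2 * k)) (j : ℕ) :
    zigzagRow (zigzagRow r j) j = r := by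
  ext
  simp only [zigzagRow]
  omega

theorem sparse_along_zigzag {k n : ℕ} {A : Fin (2 * k) × Fin n → Bool}
    (hA : ¬ hasAnti (2 * k) n A) (hM : ¬ hasMain (2 * k) n A) (r : Fin (2 * k))
    (j : ℕ) (hj : j + 1 < n) :
    ¬ (A (zigzagRow r j, ⟨j, by omega⟩) = true ∧ A (zigzagRow r (j + 1), ⟨j + 1, hj⟩) = true) := by
  rintro ⟨h1, h2⟩
  have hr := r.2
  rcases Nat.mod_two_eq_zero_or_one (r + j) with h | h
  · refine hM ⟨2 * (r / 2), j, by omega, hj, ?_, ?_⟩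
    · convert h1 using 4; simp only [zigzagRow]; omega
    · convert h2 using 4; simp only [zigzagRow]; omega
  · refine hA ⟨2 * (r / 2), j, by omega, hj, ?_, ?_⟩
    · convert h1 using 4; simp only [zigzagRow]; omega
    · convert h2 using 4; simp only [zigzagRow]; omega

theorem M_two_mul_le (k n : ℕ) : M (2 * k) n ≤ Nat.card (SparseWord n) ^ (2 * k) := by
  have hcard : Nat.card (Fin (2 * k) → SparseWord n) = Nat.card (SparseWord n) ^ (2 * k) := by
    simp [Nat.card_fun]
  rw [← hcard]
  refine Nat.card_le_card_of_injective
    (fun A r => ⟨fun j => A.1 (zigzagRow r j, j), sparse_along_zigzag A.2.1 A.2.2 r⟩) ?_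
  intro A B h
  refine Subtype.ext (funext fun ⟨r, j⟩ => ?_)
  have := congrFun (congrArg Subtype.val (congrFun h (zigzagRow r j))) j
  simpa only [zigzagRow_zigzagRow] using this

theorem M_two_mul_le_goldenRatio_pow (k n : ℕ) :
    (M (2 * k) n : ℝ) ≤ Real.goldenRatio ^ ((n + 1) * (2 * k)) := by
  have h1 : (M (2 * k) n : ℝ) ≤ (Nat.card (SparseWord n) : ℝ) ^ (2 * k) := by
    exact_mod_cast M_two_mul_le k n
  have h2 : (Nat.card (SparseWord n) : ℝ) ≤ Real.goldenRatio ^ (n + 1) :=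
    (Nat.cast_le.2 (SparseWord.card_le_fib n)).trans (fib_le_goldenRatio_pow (n + 1))
  rw [pow_mul]
  exact h1.trans (pow_le_pow_left₀ (Nat.cast_nonneg _) h2 _)

theorem M_two_mul_rpow_le {n : ℕ} (hn : 0 < n) :
    (M (2 * n) n : ℝ) ^ (1 / (((2 * n : ℕ) : ℝ) * (n : ℝ))) ≤
      Real.goldenRatio ^ (1 + 1 / (n : ℝ)) := by
  have hn' : (n : ℝ) ≠ 0 := by positivity
  refine (Real.rpow_le_rpow (Nat.cast_nonneg _) (M_two_mul_le_goldenRatio_pow n n)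
    (by positivity)).trans_eq ?_
  rw [← Real.rpow_natCast, ← Real.rpow_mul Real.goldenRatio_pos.le]
  congr 1
  push_cast
  field_simp

open Filter in
theorem M_root_limit_le (L : ℝ)
    (hL : Tendsto (fun p : ℕ × ℕ => (M p.1 p.2 : ℝ) ^ (1 / ((p.1 : ℝ) * (p.2 : ℝ))))
      (atTop ×ˢ atTop) (nhds L)) :
    L ≤ (1 + Real.sqrt 5) / 2 := by
  have hp : Tendsto (fun n : ℕ => (2 * n, n)) atTop (atTop ×ˢ atTop) :=
    (tendsto_id.const_mul_atTop' two_pos).prodMk tendsto_id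
  have hexp : Tendsto (fun n : ℕ => Real.goldenRatio ^ (1 + 1 / (n : ℝ))) atTop
      (nhds Real.goldenRatio) := by
    have := (tendsto_const_nhds (x := Real.goldenRatio)).rpow
      ((tendsto_const_nhds (x := (1 : ℝ))).add tendsto_one_div_atTop_nhds_zero_nat)
      (Or.inl Real.goldenRatio_ne_zero)
    simpa using this
  refine le_of_tendsto_of_tendsto (hL.comp hp) hexp ?_
  filter_upwards [eventually_gt_atTop 0] with n hn
  exact M_two_mul_rpow_le hn
end

section
/- For all natural numbers m, n, the number L_{m,n} equals the number of partitions of the set Fin(m+1) × Fin(n+1) all of whose blocks are either singletons or 2×2 squares, i.e., sets of the form {(i,j), (i+1,j), (i,j+1), (i+1,j+1)}. (In other words, L_{m,n} equals the number of tilings of an (m+1)×(n+1) board with square tiles of sizes 1×1 and 2×2.) -/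
/-- There exist indices `i, j` with `A (i, j) = A (i, j+1) = 1` (horizontal pair). -/
def hasHoriz (m n : ℕ) (A : Fin m × Fin n → Bool) : Prop :=
  ∃ i j, ∃ (hi : i < m) (hj : j + 1 < n),
    A (⟨i, hi⟩, ⟨j, by omega⟩) = true ∧ A (⟨i, hi⟩, ⟨j + 1, hj⟩) = true

/-- There exist indices `i, j` with `A (i, j) = A (i+1, j) = 1` (vertical pair). -/
def hasVert (m n : ℕ) (A : Fin m × Fin n → Bool) : Prop :=
  ∃ i j, ∃ (hi : i + 1 < m) (hj : j < n),
    A (⟨i, by omega⟩, ⟨j, hj⟩) = true ∧ A (⟨i + 1, hi⟩, ⟨j, hj⟩) = true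

/-- `L m n`: the number of `m × n` binary matrices with no two 1's in adjacent cells in any
of the four directions (horizontal, vertical, or either diagonal). -/
noncomputable def L (m n : ℕ) : ℕ :=
  Nat.card {A : Fin m × Fin n → Bool //
    ¬ hasAnti m n A ∧ ¬ hasMain m n A ∧ ¬ hasHoriz m n A ∧ ¬ hasVert m n A}

/-- A block of a partition of the `(m+1) × (n+1)` board is a `2 × 2` square. -/
def isSquareBlock (m n : ℕ) (b : Finset (Fin (m + 1) × Fin (n + 1))) : Prop :=
  ∃ i j, ∃ (hi : i + 1 < m + 1) (hj : j + 1 < n + 1),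
    b = {(⟨i, by omega⟩, ⟨j, by omega⟩), (⟨i + 1, hi⟩, ⟨j, by omega⟩),
         (⟨i, by omega⟩, ⟨j + 1, hj⟩), (⟨i + 1, hi⟩, ⟨j + 1, hj⟩)}

/-- The `2 × 2` square whose lexicographically smallest cell is `p`. -/
def square {m n : ℕ} (p : Fin m × Fin n) : Finset (Fin (m + 1) × Fin (n + 1)) :=
  {c | (c.1.val = p.1.val ∨ c.1.val = p.1.val + 1) ∧ (c.2.val = p.2.val ∨ c.2.val = p.2.val + 1)}

theorem mem_square {m n : ℕ} {p : Fin m × Fin n} {c : Fin (m + 1) × Fin (n + 1)} :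
    c ∈ square p ↔ (c.1.val = p.1.val ∨ c.1.val = p.1.val + 1) ∧
      (c.2.val = p.2.val ∨ c.2.val = p.2.val + 1) := by
  simp [square]

theorem castSucc_mem_square {m n : ℕ} (p : Fin m × Fin n) :
    (p.1.castSucc, p.2.castSucc) ∈ square p := by
  simp [mem_square]

theorem succ_mem_square {m n : ℕ} (p : Fin m × Fin n) : (p.1.succ, p.2.succ) ∈ square p := by
  simp [mem_square]

theorem square_injective {m n : ℕ} :
    Function.Injective (square : Fin m × Fin n → Finset (Fin (m + 1) × Fin (n + 1))) := by
  intro p q h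
  have h1 := castSucc_mem_square p
  have h2 := castSucc_mem_square q
  rw [h, mem_square] at h1
  rw [← h, mem_square] at h2
  simp only [Fin.val_castSucc] at h1 h2
  ext <;> omega

theorem square_ne_singleton {m n : ℕ} (p : Fin m × Fin n) (c : Fin (m + 1) × Fin (n + 1)) :
    square p ≠ {c} := by
  intro h
  have h1 := castSucc_mem_square p
  have h2 := succ_mem_square p
  rw [h, Finset.mem_singleton] at h1 h2
  have := congrArg (fun c => c.1.val) (h1.trans h2.symm)
  simp at this

theorem isSquareBlock_iff_exists_square {m n : ℕ} {b : Finset (Fin (m + 1) × Fin (n + 1))} :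
    isSquareBlock m n b ↔ ∃ p : Fin m × Fin n, b = square p := by
  have key (i j : ℕ) (hi : i + 1 < m + 1) (hj : j + 1 < n + 1) :
      ({(⟨i, by omega⟩, ⟨j, by omega⟩), (⟨i + 1, hi⟩, ⟨j, by omega⟩),
         (⟨i, by omega⟩, ⟨j + 1, hj⟩), (⟨i + 1, hi⟩, ⟨j + 1, hj⟩)} :
        Finset (Fin (m + 1) × Fin (n + 1))) =
      square ((⟨i, by omega⟩, ⟨j, by omega⟩) : Fin m × Fin n) := by
    ext ⟨a, c⟩
    simp only [mem_square, Finset.mem_insert, Finset.mem_singleton, Prod.mk.injEq, Fin.ext_iff]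
    omega
  constructor
  · rintro ⟨i, j, hi, hj, rfl⟩
    exact ⟨_, key i j hi hj⟩
  · rintro ⟨⟨⟨i, hi⟩, ⟨j, hj⟩⟩, rfl⟩
    exact ⟨i, j, by omega, by omega, (key i j _ _).symm⟩

/-- No two 1's of `A` are adjacent exactly when the squares placed at its 1's do not overlap. -/
theorem no_adjacent_iff {m n : ℕ} (A : Fin m × Fin n → Bool) :
    (¬ hasAnti m n A ∧ ¬ hasMain m n A ∧ ¬ hasHoriz m n A ∧ ¬ hasVert m n A) ↔
      ∀ p q c, A p = true → A q = true → c ∈ square p → c ∈ square q → p = q := by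
  constructor
  · rintro ⟨h1, h2, h3, h4⟩ ⟨⟨i, hi⟩, ⟨j, hj⟩⟩ ⟨⟨k, hk⟩, ⟨l, hl⟩⟩ c hp hq hcp hcq
    simp only [mem_square] at hcp hcq
    have hik : k = i ∨ k = i + 1 ∨ i = k + 1 := by omega
    have hjl : l = j ∨ l = j + 1 ∨ j = l + 1 := by omega
    rcases hik with rfl | rfl | rfl <;> rcases hjl with rfl | rfl | rfl
    · rfl
    · exact (h3 ⟨_, _, hi, hl, hp, hq⟩).elim
    · exact (h3 ⟨_, _, hi, hj, hq, hp⟩).elim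
    · exact (h4 ⟨_, _, hk, hj, hp, hq⟩).elim
    · exact (h2 ⟨_, _, hk, hl, hp, hq⟩).elim
    · exact (h1 ⟨_, _, hk, hj, hq, hp⟩).elim
    · exact (h4 ⟨_, _, hi, hj, hq, hp⟩).elim
    · exact (h1 ⟨_, _, hi, hl, hp, hq⟩).elim
    · exact (h2 ⟨_, _, hi, hj, hq, hp⟩).elim
  · intro h
    refine ⟨?_, ?_, ?_, ?_⟩ <;> rintro ⟨i, j, hi, hj, hp, hq⟩ <;>
    · have := h _ _ (⟨i + 1, by omega⟩, ⟨j + 1, by omega⟩) hp hq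
        (by simp [mem_square]) (by simp [mem_square])
      simp at this

/-- The tiling with squares at the 1's of `A` and single cells elsewhere. -/
noncomputable def tiling {m n : ℕ} (A : Fin m × Fin n → Bool)
    (hA : ∀ p q c, A p = true → A q = true → c ∈ square p → c ∈ square q → p = q) :
    Finpartition (Finset.univ : Finset (Fin (m + 1) × Fin (n + 1))) :=
  open Classical in
  Finpartition.ofExistsUnique
    {b | (∃ p, A p = true ∧ b = square p) ∨ ∃ c, (∀ p, A p = true → c ∉ square p) ∧ b = {c}}
    (fun _ _ => Finset.subset_univ _)
    (by
      intro c _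
      simp only [Finset.mem_filter, Finset.mem_univ, true_and]
      by_cases hc : ∃ p, A p = true ∧ c ∈ square p
      · obtain ⟨p, hp, hcp⟩ := hc
        refine ⟨square p, ⟨.inl ⟨p, hp, rfl⟩, hcp⟩, ?_⟩
        rintro b ⟨⟨q, hq, rfl⟩ | ⟨d, hd, rfl⟩, hb⟩
        · rw [hA p q c hp hq hcp hb]
        · rw [Finset.mem_singleton] at hb
          exact (hd p hp (hb ▸ hcp)).elim
      · push Not at hc
        refine ⟨{c}, ⟨.inr ⟨c, hc, rfl⟩, Finset.mem_singleton_self c⟩, ?_⟩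
        rintro b ⟨⟨q, hq, rfl⟩ | ⟨d, hd, rfl⟩, hb⟩
        · exact (hc q hq hb).elim
        · rw [Finset.mem_singleton.1 hb])
    (by
      simp only [Finset.mem_filter, Finset.mem_univ, true_and]
      rintro (⟨p, -, h⟩ | ⟨c, -, h⟩)
      · exact Finset.ne_empty_of_mem (castSucc_mem_square p) h.symm
      · exact Finset.singleton_ne_empty c h.symm)

theorem mem_parts_tiling {m n : ℕ} {A : Fin m × Fin n → Bool}
    {hA : ∀ p q c, A p = true → A q = true → c ∈ square p → c ∈ square q → p = q}
    {b : Finset (Fin (m + 1) × Fin (n + 1))} :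
    b ∈ (tiling A hA).parts ↔ (∃ p, A p = true ∧ b = square p) ∨
      ∃ c, (∀ p, A p = true → c ∉ square p) ∧ b = {c} := by
  simp [tiling, Finpartition.ofExistsUnique]

theorem square_mem_parts_tiling {m n : ℕ} {A : Fin m × Fin n → Bool}
    {hA : ∀ p q c, A p = true → A q = true → c ∈ square p → c ∈ square q → p = q}
    {p : Fin m × Fin n} : square p ∈ (tiling A hA).parts ↔ A p = true := by
  rw [mem_parts_tiling]
  constructor
  · rintro (⟨q, hq, h⟩ | ⟨c, -, h⟩)
    · rwa [square_injective h]
    · exact (square_ne_singleton p c h).elim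
  · exact fun h => .inl ⟨p, h, rfl⟩

/-- A part of a tiling is a part of any other tiling containing the same squares. -/
theorem parts_subset_of_square_mem_iff {m n : ℕ}
    {P Q : Finpartition (Finset.univ : Finset (Fin (m + 1) × Fin (n + 1)))}
    (hP : ∀ b ∈ P.parts, (∃ c, b = {c}) ∨ isSquareBlock m n b)
    (hQ : ∀ b ∈ Q.parts, (∃ c, b = {c}) ∨ isSquareBlock m n b)
    (h : ∀ p : Fin m × Fin n, square p ∈ P.parts ↔ square p ∈ Q.parts) :
    P.parts ⊆ Q.parts := by
  intro b hb
  rcases hP b hb with ⟨c, rfl⟩ | hsq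
  · obtain ⟨d, hd, hcd⟩ := Q.exists_mem (Finset.mem_univ c)
    rcases hQ d hd with ⟨e, rfl⟩ | hsq
    · rwa [Finset.mem_singleton.1 hcd]
    · obtain ⟨p, rfl⟩ := isSquareBlock_iff_exists_square.1 hsq
      rwa [P.eq_of_mem_parts hb ((h p).2 hd) (Finset.mem_singleton_self c) hcd]
  · obtain ⟨p, rfl⟩ := isSquareBlock_iff_exists_square.1 hsq
    exact (h p).1 hb

theorem L_eq_tilings (m n : ℕ) :
    L m n = Nat.card {P : Finpartition (Finset.univ : Finset (Fin (m + 1) × Fin (n + 1))) //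
      ∀ b ∈ P.parts, (∃ p, b = {p}) ∨ isSquareBlock m n b} := by
  classical
  symm
  refine Nat.card_eq_of_bijective (fun P => ⟨fun p => decide (square p ∈ P.1.parts), ?_⟩) ⟨?_, ?_⟩
  · rw [no_adjacent_iff]
    intro p q c hp hq hcp hcq
    exact square_injective
      (P.1.eq_of_mem_parts (of_decide_eq_true hp) (of_decide_eq_true hq) hcp hcq)
  · rintro ⟨P, hP⟩ ⟨Q, hQ⟩ h
    have h' (p : Fin m × Fin n) : square p ∈ P.parts ↔ square p ∈ Q.parts :=
      decide_eq_decide.1 (congrFun (congrArg Subtype.val h) p)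
    exact Subtype.ext (Finpartition.ext ((parts_subset_of_square_mem_iff hP hQ h').antisymm
      (parts_subset_of_square_mem_iff hQ hP fun p => (h' p).symm)))
  · rintro ⟨A, hA⟩
    refine ⟨⟨tiling A ((no_adjacent_iff A).1 hA), fun b hb => ?_⟩, ?_⟩
    · rcases mem_parts_tiling.1 hb with ⟨p, -, rfl⟩ | ⟨c, -, rfl⟩
      · exact .inr (isSquareBlock_iff_exists_square.2 ⟨p, rfl⟩)
      · exact .inl ⟨c, rfl⟩
    · ext p
      simp [square_mem_parts_tiling]
end

section
/- For every natural number n, as real numbers, M_{2,n} = (7/10)(η₁^{2n} + η₂^{2n}) + (3√5/10)(η₁^{2n} − η₂^{2n}) − (2/5)(−1)^n, where η₁ = (1+√5)/2 and η₂ = (1−√5)/2. -/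
/-- A binary word with no two consecutive 1's. -/
def IsSparseWord {n : ℕ} (f : Fin n → Bool) : Prop :=
  ∀ j (h : j + 1 < n), ¬ (f ⟨j, by omega⟩ = true ∧ f ⟨j + 1, h⟩ = true)

theorem isSparseWord_cons {n : ℕ} (b : Bool) (f : Fin (n + 1) → Bool) :
    IsSparseWord (Fin.cons b f : Fin (n + 2) → Bool) ↔
      ¬ (b = true ∧ f 0 = true) ∧ IsSparseWord f := by
  constructor
  · intro h
    have h0 := h 0 (by omega)
    exact ⟨h0, fun j hj => h (j + 1) (Nat.succ_lt_succ hj)⟩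
  · rintro ⟨h0, h⟩ j hj
    cases j with
    | zero => exact h0
    | succ j => exact h j (by omega)

theorem isSparseWord_cons_false {n : ℕ} (f : Fin n → Bool) :
    IsSparseWord (Fin.cons false f : Fin (n + 1) → Bool) ↔ IsSparseWord f := by
  cases n with
  | zero => exact ⟨fun _ j h => by omega, fun _ j h => by omega⟩
  | succ n => simp [isSparseWord_cons]

/-- A sparse word of length `n + 2` is `0` followed by a sparse word of length `n + 1`, or `10`
followed by a sparse word of length `n`. -/
def sparseWordEquiv (n : ℕ) :
    {f : Fin (n + 2) → Bool // IsSparseWord f} ≃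
      {f : Fin (n + 1) → Bool // IsSparseWord f} ⊕ {f : Fin n → Bool // IsSparseWord f} where
  toFun f :=
    if f.1 0 = true then
      .inr ⟨Fin.tail (Fin.tail f.1), fun j h => f.2 (j + 2) (by omega)⟩
    else .inl ⟨Fin.tail f.1, fun j h => f.2 (j + 1) (by omega)⟩
  invFun := Sum.elim
    (fun f => ⟨Fin.cons false f.1, (isSparseWord_cons_false f.1).2 f.2⟩)
    (fun f => ⟨Fin.cons true (Fin.cons false f.1 : Fin (n + 1) → Bool),
      (isSparseWord_cons _ _).2 ⟨by simp, (isSparseWord_cons_false f.1).2 f.2⟩⟩)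
  left_inv := by
    rintro ⟨f, hf⟩
    have h01 := hf 0 (by omega)
    by_cases h : f 0 = true
    · have h1 : f 1 = false := by
        rw [← Bool.not_eq_true]
        exact fun h1 => h01 ⟨h, h1⟩
      simp only [h, if_true, Sum.elim_inr, Subtype.mk.injEq]
      have h2 : Fin.tail f 0 = false := h1
      rw [← h2, Fin.cons_self_tail, ← h, Fin.cons_self_tail]
    · simp only [if_neg h, Sum.elim_inl, Subtype.mk.injEq]
      rw [Bool.not_eq_true] at h
      rw [← h, Fin.cons_self_tail]
  right_inv := by
    rintro (⟨f, hf⟩ | ⟨f, hf⟩) <;> simp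

theorem card_isSparseWord (n : ℕ) :
    Nat.card {f : Fin n → Bool // IsSparseWord f} = Nat.fib (n + 2) := by
  induction n using Nat.twoStepInduction with
  | zero =>
    rw [Nat.card_congr (Equiv.subtypeUnivEquiv (p := IsSparseWord) fun f j h => by omega)]
    simp
  | one =>
    rw [Nat.card_congr (Equiv.subtypeUnivEquiv (p := IsSparseWord) fun f j h => by omega)]
    simp [Nat.fib_add_two]
  | more n ih₀ ih₁ =>
    rw [Nat.card_congr (sparseWordEquiv n), Nat.card_sum, ih₀, ih₁, Nat.fib_add_two (n := n + 2),
      add_comm]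

/-- Reading a two-row matrix along its two zigzag paths: the path with index `s` visits
row `s + j` (mod `2`) in column `j`. -/
def zigzagEquiv (n : ℕ) : (Fin 2 × Fin n → Bool) ≃ (Fin 2 → Fin n → Bool) where
  toFun A s j := A (s + Fin.ofNat 2 j, j)
  invFun g p := g (p.1 + Fin.ofNat 2 p.2) p.2
  left_inv A := by
    have h : ∀ s c : Fin 2, s + c + c = s := by decide
    funext p
    simp only [h]
  right_inv g := by
    have h : ∀ s c : Fin 2, s + c + c = s := by decide
    funext s j
    simp only [h]

theorem zigzag_isSparseWord_iff {n : ℕ} (A : Fin 2 × Fin n → Bool) :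
    (¬ hasAnti 2 n A ∧ ¬ hasMain 2 n A) ↔ ∀ s, IsSparseWord (zigzagEquiv n A s) := by
  have hstep : ∀ (s : Fin 2) (j : ℕ), s + Fin.ofNat 2 (j + 1) = s + Fin.ofNat 2 j + 1 := by
    intro s j
    ext
    simp [Fin.val_add]
    omega
  have hinv : ∀ s c : Fin 2, s + c + c = s := by decide
  constructor
  · rintro ⟨ha, hm⟩ s j hj ⟨h1, h2⟩
    simp only [zigzagEquiv, Equiv.coe_fn_mk, hstep] at h1 h2
    generalize s + Fin.ofNat 2 j = r at h1 h2
    fin_cases r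
    · exact hm ⟨0, j, by omega, hj, h1, h2⟩
    · exact ha ⟨0, j, by omega, hj, h1, h2⟩
  · intro h
    have key : ∀ (r : Fin 2) (j : ℕ) (hj : j + 1 < n),
        ¬ (A (r, ⟨j, by omega⟩) = true ∧ A (r + 1, ⟨j + 1, hj⟩) = true) := by
      intro r j hj
      have := h (r + Fin.ofNat 2 j) j hj
      simpa only [zigzagEquiv, Equiv.coe_fn_mk, hstep, hinv] using this
    constructor
    · rintro ⟨i, j, hi, hj, h1, h2⟩
      obtain rfl : i = 0 := by omega
      exact key 1 j hj ⟨h1, h2⟩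
    · rintro ⟨i, j, hi, hj, h1, h2⟩
      obtain rfl : i = 0 := by omega
      exact key 0 j hj ⟨h1, h2⟩

theorem M_two_eq_fib_sq (n : ℕ) : M 2 n = Nat.fib (n + 2) ^ 2 := by
  unfold M
  rw [Nat.card_congr ((zigzagEquiv n).subtypeEquiv
      (q := fun g => ∀ s, IsSparseWord (g s)) zigzag_isSparseWord_iff),
    Nat.card_congr (Equiv.subtypePiEquivPi (p := fun _ : Fin 2 => IsSparseWord)), Nat.card_pi]
  simp [card_isSparseWord]

theorem M_two_formula (n : ℕ) :
    (M 2 n : ℝ) =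
      (7 / 10) * (((1 + Real.sqrt 5) / 2) ^ (2 * n) + ((1 - Real.sqrt 5) / 2) ^ (2 * n)) +
      (3 * Real.sqrt 5 / 10) *
        (((1 + Real.sqrt 5) / 2) ^ (2 * n) - ((1 - Real.sqrt 5) / 2) ^ (2 * n)) -
      (2 / 5) * (-1) ^ n := by
  have h5 : Real.sqrt 5 ^ 2 = 5 := Real.sq_sqrt (by norm_num)
  have hprod : ((1 + Real.sqrt 5) / 2) * ((1 - Real.sqrt 5) / 2) = -1 := by
    linear_combination (-1 / 4) * h5
  rw [M_two_eq_fib_sq, Nat.cast_pow, Real.coe_fib_eq, Real.goldenRatio, Real.goldenConj, div_pow, h5,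
    ← hprod, mul_pow]
  have ha : ((1 + Real.sqrt 5) / 2) ^ 2 = (3 + Real.sqrt 5) / 2 := by
    linear_combination (1 / 4) * h5
  have hb : ((1 - Real.sqrt 5) / 2) ^ 2 = (3 - Real.sqrt 5) / 2 := by
    linear_combination (1 / 4) * h5
  rw [pow_add, pow_add, ha, hb, mul_comm 2 n, pow_mul, pow_mul]
  generalize ((1 + Real.sqrt 5) / 2) ^ n = x
  generalize ((1 - Real.sqrt 5) / 2) ^ n = y
  linear_combination ((x + y) ^ 2 / 20) * h5
end

section
/- For every natural number n, as real numbers, M_{3,n} = (1/13)(η₁^{n+2} + η₂^{n+2}) + (√3^{n+1}/13)·(4 − √3 − (4 + √3)(−1)^n), where η₁ = (5+√13)/2 and η₂ = (5−√13)/2. -/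
/-- Consecutive terms of the finite sequence `c` are related by `r`. -/
def IsWalk {α : Type*} (r : α → α → Prop) {n : ℕ} (c : Fin n → α) : Prop :=
  ∀ j (h : j + 1 < n), r (c ⟨j, by omega⟩) (c ⟨j + 1, h⟩)

/-- The number of `n`-step walks along `r` starting at a given point. -/
def walkCount {α : Type*} [Fintype α] (r : α → α → Prop) [DecidableRel r] : ℕ → α → ℕ
  | 0, _ => 1
  | n + 1, u => ∑ v, if r u v then walkCount r n v else 0

theorem isWalk_cons_cons {α : Type*} (r : α → α → Prop) {n : ℕ} (u v : α) (c : Fin n → α) :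
    IsWalk r (Fin.cons u (Fin.cons v c : Fin (n + 1) → α) : Fin (n + 2) → α) ↔
      r u v ∧ IsWalk r (Fin.cons v c : Fin (n + 1) → α) := by
  constructor
  · intro h
    refine ⟨?_, fun j hj => h (j + 1) (by omega)⟩
    simpa using h 0 (by omega)
  · rintro ⟨h₀, h⟩ j hj
    cases j with
    | zero => exact h₀
    | succ j => exact h j (by omega)

theorem isWalk_cons_iff {α : Type*} (r : α → α → Prop) {u : α} (hu : ∀ v, r u v) {n : ℕ}
    (c : Fin n → α) : IsWalk r (Fin.cons u c : Fin (n + 1) → α) ↔ IsWalk r c := by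
  constructor
  · intro h j hj
    exact h (j + 1) (by omega)
  · intro h j hj
    cases j with
    | zero => exact hu _
    | succ j => exact h j (by omega)

open Classical in
theorem sum_isWalk_cons {α : Type*} [Fintype α] (r : α → α → Prop) [DecidableRel r] (n : ℕ) :
    ∀ u : α, (∑ c : Fin n → α, if IsWalk r (Fin.cons u c : Fin (n + 1) → α) then 1 else 0) =
      walkCount r n u := by
  induction n with
  | zero =>
    intro u
    have h (c : Fin 0 → α) : IsWalk r (Fin.cons u c : Fin 1 → α) := fun j hj => by omega
    simp [h, walkCount]
  | succ n ih =>
    intro u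
    rw [← (Fin.consEquiv fun _ : Fin (n + 1) => α).sum_comp, Fintype.sum_prod_type, walkCount]
    refine Finset.sum_congr rfl fun v _ => ?_
    rw [← ih v]
    simp only [Fin.consEquiv, Equiv.coe_fn_mk, isWalk_cons_cons]
    by_cases h : r u v <;> simp [h]

theorem card_isWalk_cons {α : Type*} [Fintype α] (r : α → α → Prop) [DecidableRel r] (n : ℕ)
    (u : α) : Nat.card {c : Fin n → α // IsWalk r (Fin.cons u c : Fin (n + 1) → α)} =
      walkCount r n u := by
  classical
  rw [← sum_isWalk_cons, Nat.card_eq_fintype_card, Fintype.card_subtype, Finset.card_filter]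

/-- Two columns of height three may stand next to each other. -/
abbrev ColumnCompat (u v : Bool × Bool × Bool) : Prop :=
  ¬ (u.1 ∧ v.2.1) ∧ ¬ (u.2.1 ∧ v.1) ∧ ¬ (u.2.1 ∧ v.2.2) ∧ ¬ (u.2.2 ∧ v.2.1)

/-- A matrix with three rows as a sequence of columns. -/
def columnEquiv (n : ℕ) : (Fin 3 × Fin n → Bool) ≃ (Fin n → Bool × Bool × Bool) where
  toFun A j := (A (0, j), A (1, j), A (2, j))
  invFun c p := ![(c p.2).1, (c p.2).2.1, (c p.2).2.2] p.1
  left_inv A := by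
    ext ⟨i, j⟩
    fin_cases i <;> rfl
  right_inv c := rfl

theorem isWalk_columnEquiv_iff {n : ℕ} (A : Fin 3 × Fin n → Bool) :
    ¬ hasAnti 3 n A ∧ ¬ hasMain 3 n A ↔ IsWalk ColumnCompat (columnEquiv n A) := by
  constructor
  · rintro ⟨ha, hm⟩ j hj
    exact ⟨fun h => hm ⟨0, j, by omega, hj, h⟩, fun h => ha ⟨0, j, by omega, hj, h⟩,
      fun h => hm ⟨1, j, by omega, hj, h⟩, fun h => ha ⟨1, j, by omega, hj, h⟩⟩
  · intro h
    constructor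
    · rintro ⟨i, j, hi, hj, hA⟩
      obtain ⟨-, h₁, -, h₂⟩ := h j hj
      obtain rfl | rfl : i = 0 ∨ i = 1 := by omega
      exacts [h₁ hA, h₂ hA]
    · rintro ⟨i, j, hi, hj, hA⟩
      obtain ⟨h₁, -, h₂, -⟩ := h j hj
      obtain rfl | rfl : i = 0 ∨ i = 1 := by omega
      exacts [h₁ hA, h₂ hA]

theorem M_three_eq_walkCount (n : ℕ) :
    M 3 n = walkCount ColumnCompat n (false, false, false) := by
  rw [← card_isWalk_cons, M]
  refine Nat.card_congr ((columnEquiv n).subtypeEquiv fun A => ?_)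
  rw [isWalk_columnEquiv_iff, isWalk_cons_iff _ (by decide)]

theorem walkCount_column (n : ℕ) (a b c : Bool) :
    walkCount ColumnCompat n (a, b, c) = walkCount ColumnCompat n (a || c, b, false) := by
  cases n with
  | zero => rfl
  | succ n =>
    simp only [walkCount]
    refine Finset.sum_congr rfl fun v _ => if_congr ?_ rfl rfl
    revert a b c v
    decide

theorem walkCount_column_succ (n : ℕ) (a b : Bool) :
    walkCount ColumnCompat (n + 1) (a, b, false) =
      walkCount ColumnCompat n (false, false, false) +
      (if b then 0 else 3 * walkCount ColumnCompat n (true, false, false)) +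
      (if a then 0 else walkCount ColumnCompat n (false, true, false)) +
      (if a || b then 0 else 3 * walkCount ColumnCompat n (true, true, false)) := by
  rw [walkCount]
  simp only [walkCount_column n _ _ true, Fintype.sum_prod_type, Fintype.sum_bool]
  cases a <;> cases b <;> simp [ColumnCompat] <;> ring

theorem M_three_recurrence (n : ℕ) :
    M 3 (n + 4) + 15 * M 3 (n + 1) = 5 * M 3 (n + 3) + 9 * M 3 n := by
  simp only [M_three_eq_walkCount, walkCount_column_succ, Bool.or_false, Bool.or_true,
    Bool.false_eq_true, if_true, if_false]
  ring

theorem M_three_initial : M 3 0 = 1 ∧ M 3 1 = 8 ∧ M 3 2 = 25 ∧ M 3 3 = 119 := by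
  simp only [M_three_eq_walkCount]
  refine ⟨rfl, rfl, rfl, rfl⟩

theorem M_three_formula (n : ℕ) :
    (M 3 n : ℝ) =
      (1 / 13) * (((5 + Real.sqrt 13) / 2) ^ (n + 2) + ((5 - Real.sqrt 13) / 2) ^ (n + 2)) +
      (Real.sqrt 3 ^ (n + 1) / 13) *
        (4 - Real.sqrt 3 - (4 + Real.sqrt 3) * (-1) ^ n) := by
  have h13 : Real.sqrt 13 ^ 2 = 13 := Real.sq_sqrt (by norm_num)
  have h3 : Real.sqrt 3 ^ 2 = 3 := Real.sq_sqrt (by norm_num)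
  have hp : ((5 + Real.sqrt 13) / 2) ^ 2 = 5 * ((5 + Real.sqrt 13) / 2) - 3 := by
    linear_combination h13 / 4
  have hq : ((5 - Real.sqrt 13) / 2) ^ 2 = 5 * ((5 - Real.sqrt 13) / 2) - 3 := by
    linear_combination h13 / 4
  have hpq : (5 - Real.sqrt 13) / 2 = 5 - (5 + Real.sqrt 13) / 2 := by ring
  generalize (5 + Real.sqrt 13) / 2 = p at *
  generalize (5 - Real.sqrt 13) / 2 = q at *
  generalize Real.sqrt 3 = s at *
  induction n using Nat.strong_induction_on with
  | _ n ih =>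
  obtain ⟨h₀, h₁, h₂, h₃⟩ := M_three_initial
  match n with
  | 0 | 1 | 2 | 3 =>
    simp only [h₀, h₁, h₂, h₃]
    norm_num
    grind
  | n + 4 =>
    have h : (M 3 (n + 4) : ℝ) = 5 * M 3 (n + 3) - 15 * M 3 (n + 1) + 9 * M 3 n := by
      have := congrArg (Nat.cast (R := ℝ)) (M_three_recurrence n)
      push_cast at this
      linarith
    rw [h, ih (n + 3) (by omega), ih (n + 1) (by omega), ih n (by omega)]
    simp only [pow_add]
    generalize p ^ n = P
    generalize q ^ n = Q
    generalize s ^ n = S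
    generalize (-1 : ℝ) ^ n = e
    grind
end

section
/- For all natural numbers m and n, M_{2m,n} is a perfect square: there exists a natural number a with M_{2m,n} = a². -/
/-- The Boolean indicator functions of the independent sets of a relation. -/
def IsIndep {V : Type*} (r : V → V → Prop) (f : V → Bool) : Prop :=
  ∀ x y, r x y → ¬ (f x = true ∧ f y = true)

/-- If no related points differ in colour and an involution `ρ` reverses the relation and swaps the
two colours, then an independent set amounts to a pair of independent sets of the first colour. -/
def indepEquivProd {V : Type*} {r : V → V → Prop} {c : V → Bool} {ρ : V → V}
    (hc : ∀ x y, r x y → c x = c y) (hρ : Function.Involutive ρ)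
    (hr : ∀ x y, r x y → r (ρ y) (ρ x)) (hcρ : ∀ x, c (ρ x) = !c x) :
    {f // IsIndep r f} ≃
      {f // IsIndep r f ∧ ∀ x, f x = true → c x = true} ×
        {f // IsIndep r f ∧ ∀ x, f x = true → c x = true} where
  toFun f :=
    (⟨fun x => c x && f.1 x, fun x y h => by have := f.2 x y h; grind, by grind⟩,
      ⟨fun x => c x && f.1 (ρ x),
        fun x y h => by have := f.2 _ _ (hr x y h); grind, by grind⟩)
  invFun p := ⟨fun x => if c x then p.1.1 x else p.2.1 (ρ x), fun x y h => by
    have h₁ := p.1.2.1 x y h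
    have h₂ := p.2.2.1 _ _ (hr x y h)
    have h₃ := hc x y h
    grind⟩
  left_inv f := by
    ext x
    have := hρ x
    have := hcρ x
    grind
  right_inv p := by
    obtain ⟨⟨g, hg, hgc⟩, h, hh, hhc⟩ := p
    refine Prod.ext (Subtype.ext (funext fun x => ?_)) (Subtype.ext (funext fun x => ?_))
    · have := hgc x
      grind
    · have := hρ x
      have := hcρ x
      have := hhc x
      grind

/-- The cell `q` lies in the row after that of `p` and is diagonally adjacent to `p`. -/
def DiagAdj {m n : ℕ} (p q : Fin m × Fin n) : Prop :=
  q.1.val = p.1.val + 1 ∧ (q.2.val = p.2.val + 1 ∨ p.2.val = q.2.val + 1)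

theorem not_hasAnti_and_not_hasMain_iff_isIndep {m n : ℕ} (A : Fin m × Fin n → Bool) :
    ¬ hasAnti m n A ∧ ¬ hasMain m n A ↔ IsIndep DiagAdj A := by
  constructor
  · rintro ⟨hanti, hmain⟩ ⟨⟨i, hi⟩, ⟨j, hj⟩⟩ ⟨⟨k, hk⟩, ⟨l, hl⟩⟩ ⟨hik, hjl⟩ ⟨hp, hq⟩
    dsimp only at hik hjl
    subst hik
    rcases hjl with rfl | rfl
    · exact hmain ⟨i, j, hk, hl, hp, hq⟩
    · exact hanti ⟨i, l, hk, hj, hq, hp⟩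
  · intro h
    constructor
    · rintro ⟨i, j, hi, hj, hp, hq⟩
      exact h _ _ ⟨rfl, Or.inr rfl⟩ ⟨hq, hp⟩
    · rintro ⟨i, j, hi, hj, hp, hq⟩
      exact h _ _ ⟨rfl, Or.inl rfl⟩ ⟨hp, hq⟩

theorem M_even_rows_perfect_square (m n : ℕ) : ∃ a : ℕ, M (2 * m) n = a ^ 2 := by
  let c : Fin (2 * m) × Fin n → Bool := fun p => decide ((p.1.val + p.2.val) % 2 = 0)
  let ρ : Fin (2 * m) × Fin n → Fin (2 * m) × Fin n := fun p => (p.1.rev, p.2)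
  have hc : ∀ x y, DiagAdj x y → c x = c y := by
    rintro x y ⟨h₁, h₂⟩
    simp only [c, decide_eq_decide]
    omega
  have hρ : Function.Involutive ρ := fun p => by simp [ρ]
  have hr : ∀ x y, DiagAdj x y → DiagAdj (ρ y) (ρ x) := by
    rintro x y ⟨h₁, h₂⟩
    simp only [DiagAdj, ρ, Fin.val_rev]
    omega
  have hcρ : ∀ x, c (ρ x) = !c x := by
    intro x
    simp only [c, ρ, Fin.val_rev, ← decide_not, decide_eq_decide]
    omega
  refine ⟨Nat.card {f // IsIndep DiagAdj f ∧ ∀ x, f x = true → c x = true}, ?_⟩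
  rw [M, Nat.card_congr (Equiv.subtypeEquivRight not_hasAnti_and_not_hasMain_iff_isIndep),
    Nat.card_congr (indepEquivProd hc hρ hr hcρ), Nat.card_prod, sq]
end

section
/- For all natural numbers m and n, B_{2m,n} = W_{2m,n}: on a chessboard with an even number 2m of rows, the number of placements of mutually nonattacking pawns on the black squares equals the number of placements of mutually nonattacking pawns on the white squares. -/
/-- Cells `p` and `q` of the grid are diagonally adjacent: `|i - i'| = 1` and `|j - j'| = 1`. -/
def diagAdj {m n : ℕ} (p q : Fin m × Fin n) : Prop :=
  |(p.1 : ℤ) - (q.1 : ℤ)| = 1 ∧ |(p.2 : ℤ) - (q.2 : ℤ)| = 1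

/-- `B m n`: the number of sets of black squares (cells `(i, j)` with `i + j` even) of an
`m × n` board, no two of which are diagonally adjacent. -/
noncomputable def B (m n : ℕ) : ℕ :=
  Nat.card {S : Finset (Fin m × Fin n) //
    (∀ p ∈ S, Even ((p.1 : ℕ) + (p.2 : ℕ))) ∧ ∀ p ∈ S, ∀ q ∈ S, ¬ diagAdj p q}

/-- `W m n`: the number of sets of white squares (cells `(i, j)` with `i + j` odd) of an
`m × n` board, no two of which are diagonally adjacent. -/
noncomputable def W (m n : ℕ) : ℕ :=
  Nat.card {S : Finset (Fin m × Fin n) //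
    (∀ p ∈ S, Odd ((p.1 : ℕ) + (p.2 : ℕ))) ∧ ∀ p ∈ S, ∀ q ∈ S, ¬ diagAdj p q}

/-- Reflecting the board in its horizontal midline preserves diagonal adjacency. -/
theorem diagAdj_rev_iff {m n : ℕ} (p q : Fin m × Fin n) :
    diagAdj (p.1.rev, p.2) (q.1.rev, q.2) ↔ diagAdj p q := by
  have h : ((p.1.rev : ℕ) : ℤ) - ((q.1.rev : ℕ) : ℤ) = (q.1 : ℤ) - (p.1 : ℤ) := by
    simp only [Fin.val_rev]
    omega
  simp only [diagAdj, h, abs_sub_comm (q.1 : ℤ) (p.1 : ℤ)]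

/-- With an even number of rows, the horizontal reflection exchanges the two colours. -/
theorem odd_rev_add_iff {m n : ℕ} (p : Fin (2 * m) × Fin n) :
    Odd ((p.1.rev : ℕ) + (p.2 : ℕ)) ↔ Even ((p.1 : ℕ) + (p.2 : ℕ)) := by
  rw [Nat.odd_iff, Nat.even_iff, Fin.val_rev]
  omega

theorem black_eq_white_even_rows (m n : ℕ) : B (2 * m) n = W (2 * m) n := by
  refine Nat.card_congr ((Equiv.finsetCongr
    (Equiv.prodCongr Fin.revPerm (Equiv.refl (Fin n)))).subtypeEquiv fun S => ?_)
  simp only [Equiv.finsetCongr_apply, Finset.forall_mem_map, Equiv.coe_toEmbedding,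
    Equiv.prodCongr_apply, Prod.map, Fin.revPerm_apply, Equiv.refl_apply,
    odd_rev_add_iff, diagAdj_rev_iff]
end

section
/- Define t : ℤ → ℝ by t(k) = (1/√13)·( ((5+√13)/2)^{k+1} − ((5−√13)/2)^{k+1} ) for k ≥ −1 (so t(−1) = 0 and t(0) = 1). Then for every natural number n, as real numbers, M_{3,2n} = t(n)² and M_{3,2n+1} = (4·t(n) − 3·t(n−1)) · (2·t(n) − 3·t(n−1)). -/
/-- `t k = (1/√13) ((5+√13)/2)^(k+1) − ((5−√13)/2)^(k+1))`, so `t (-1) = 0` and `t 0 = 1`. -/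
noncomputable def t (k : ℤ) : ℝ :=
  (1 / Real.sqrt 13) *
    (((5 + Real.sqrt 13) / 2) ^ (k + 1) - ((5 - Real.sqrt 13) / 2) ^ (k + 1))

/-- Two adjacent columns of an `m`-row board, with no two diagonally adjacent 1's. -/
def ColumnsCompatible {m : ℕ} (s s' : Fin m → Bool) : Prop :=
  ∀ i j : Fin m, (i.val + 1 = j.val ∨ j.val + 1 = i.val) → ¬ (s i = true ∧ s' j = true)

instance {m : ℕ} (s s' : Fin m → Bool) : Decidable (ColumnsCompatible s s') := by
  unfold ColumnsCompatible; infer_instance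

/-- Consecutive columns are compatible. -/
def ColumnChain {m n : ℕ} (v : Fin (n + 1) → Fin m → Bool) : Prop :=
  ∀ i : Fin n, ColumnsCompatible (v i.castSucc) (v i.succ)

instance {m n : ℕ} (v : Fin (n + 1) → Fin m → Bool) : Decidable (ColumnChain v) := by
  unfold ColumnChain; infer_instance

/-- The number of ways to continue the column `s` by `n` further columns. -/
def continuations (m n : ℕ) (s : Fin m → Bool) : ℕ :=
  ∑ B : Fin n → Fin m → Bool,
    if ColumnChain (Fin.cons s B : Fin (n + 1) → Fin m → Bool) then 1 else 0

theorem continuations_zero (m : ℕ) (s : Fin m → Bool) : continuations m 0 s = 1 := by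
  simp [continuations, ColumnChain]

theorem columnChain_cons_cons {m n : ℕ} (s s' : Fin m → Bool) (B : Fin n → Fin m → Bool) :
    ColumnChain (Fin.cons s (Fin.cons s' B : Fin (n + 1) → Fin m → Bool) :
        Fin (n + 2) → Fin m → Bool) ↔
      ColumnsCompatible s s' ∧ ColumnChain (Fin.cons s' B : Fin (n + 1) → Fin m → Bool) := by
  unfold ColumnChain
  rw [Fin.forall_fin_succ]
  simp

theorem continuations_succ (m n : ℕ) (s : Fin m → Bool) :
    continuations m (n + 1) s =
      ∑ s', if ColumnsCompatible s s' then continuations m n s' else 0 := by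
  unfold continuations
  rw [← (Fin.consEquiv fun _ : Fin (n + 1) => Fin m → Bool).sum_comp, Fintype.sum_prod_type]
  refine Finset.sum_congr rfl fun s' _ => ?_
  change (∑ B : Fin n → Fin m → Bool, if ColumnChain (Fin.cons s
    (Fin.cons s' B : Fin (n + 1) → Fin m → Bool) : Fin (n + 2) → Fin m → Bool) then 1 else 0) = _
  simp only [columnChain_cons_cons]
  split_ifs with h <;> simp [h]

theorem columnChain_cons_false_iff {m n : ℕ} (A : Fin m × Fin n → Bool) :
    ColumnChain (Fin.cons (fun _ => false) (fun j i => A (i, j)) : Fin (n + 1) → Fin m → Bool) ↔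
      ¬ hasAnti m n A ∧ ¬ hasMain m n A := by
  constructor
  · intro h
    have key : ∀ (i i' : Fin m) (j : ℕ) (hj : j + 1 < n),
        (i.val + 1 = i'.val ∨ i'.val + 1 = i.val) →
        ¬ (A (i, ⟨j, by omega⟩) = true ∧ A (i', ⟨j + 1, hj⟩) = true) := by
      intro i i' j hj hi
      exact h ⟨j + 1, hj⟩ i i' hi
    constructor
    · rintro ⟨i, j, hi, hj, h₁, h₂⟩
      exact key _ _ j hj (Or.inr rfl) ⟨h₁, h₂⟩
    · rintro ⟨i, j, hi, hj, h₁, h₂⟩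
      exact key _ _ j hj (Or.inl rfl) ⟨h₁, h₂⟩
  · rintro ⟨hanti, hmain⟩ ⟨_ | j, hj⟩ ⟨i, hi⟩ ⟨i', hi'⟩ hii' ⟨h₁, h₂⟩
    · exact Bool.false_ne_true h₁
    · rcases hii' with h | h <;> dsimp only at h <;> subst h
      · exact hmain ⟨i, j, hi', hj, h₁, h₂⟩
      · exact hanti ⟨i', j, hi, hj, h₁, h₂⟩

theorem M_eq_continuations (m n : ℕ) : M m n = continuations m n fun _ => false := by
  classical
  let e : (Fin m × Fin n → Bool) ≃ (Fin n → Fin m → Bool) :=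
    ((Equiv.prodComm (Fin m) (Fin n)).arrowCongr (Equiv.refl Bool)).trans (Equiv.curry _ _ _)
  unfold M continuations
  rw [Nat.card_eq_fintype_card, Fintype.card_subtype, Finset.card_filter, ← e.sum_comp]
  refine Finset.sum_congr rfl fun A _ => ?_
  simp only [← columnChain_cons_false_iff]
  rfl

/-- On three rows the number of continuations factors, the middle cell and the two outer cells of
a column having opposite colours. This predicate records the four values of the factors. -/
def ContinuationsFactor (n : ℕ) (a b x y : ℝ) : Prop :=
  ∀ s : Fin 3 → Bool, (continuations 3 n s : ℝ) =
    (if s 1 = true then b else a) * (if s 0 = true ∨ s 2 = true then y else x)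

theorem sum_fin_three_bool (f : (Fin 3 → Bool) → ℝ) :
    ∑ s, f s = ∑ a, ∑ b, ∑ c, f ![a, b, c] := by
  let e : Bool × Bool × Bool ≃ (Fin 3 → Bool) :=
    { toFun := fun p => ![p.1, p.2.1, p.2.2]
      invFun := fun s => (s 0, s 1, s 2)
      left_inv := fun _ => rfl
      right_inv := fun s => by
        ext i
        fin_cases i <;> rfl }
  rw [← e.sum_comp, Fintype.sum_prod_type]
  simp only [Fintype.sum_prod_type]
  rfl

theorem ContinuationsFactor.succ {n : ℕ} {a b x y : ℝ} (h : ContinuationsFactor n a b x y) :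
    ContinuationsFactor (n + 1) (x + 3 * y) x (a + b) a := by
  intro s
  have hc (s s' : Fin 3 → Bool) : ColumnsCompatible s s' ↔
      ¬ (s 0 = true ∧ s' 1 = true) ∧ ¬ (s 2 = true ∧ s' 1 = true) ∧
        ¬ (s 1 = true ∧ s' 0 = true) ∧ ¬ (s 1 = true ∧ s' 2 = true) := by
    simp [ColumnsCompatible, Fin.forall_fin_succ]
    tauto
  rw [continuations_succ]
  push_cast
  simp only [h _, hc]
  simp only [sum_fin_three_bool, Fintype.sum_bool]
  cases s 0 <;> cases s 1 <;> cases s 2 <;> simp <;> ring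

theorem continuationsFactor_zero : ContinuationsFactor 0 1 1 1 1 := by
  intro s
  simp [continuations_zero]

theorem ContinuationsFactor.M_eq {n : ℕ} {a b x y : ℝ} (h : ContinuationsFactor n a b x y) :
    (M 3 n : ℝ) = a * x := by
  rw [M_eq_continuations, h]
  simp

theorem t_neg_one : t (-1) = 0 := by
  simp [t]

theorem t_zero : t 0 = 1 := by
  have h : Real.sqrt 13 ≠ 0 := by positivity
  simp only [t, zero_add, zpow_one]
  field_simp
  ring

theorem t_add_one (k : ℤ) : t (k + 1) = 5 * t k - 3 * t (k - 1) := by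
  have hs : Real.sqrt 13 ^ 2 = 13 := Real.sq_sqrt (by norm_num)
  have hp : (5 + Real.sqrt 13) / 2 ≠ 0 := by positivity
  have hq : (5 - Real.sqrt 13) / 2 ≠ 0 := by
    intro h
    nlinarith
  have hzpow {r : ℝ} (hr : r ≠ 0) (hr' : r ^ 2 = 5 * r - 3) :
      r ^ (k + 1 + 1) = 5 * r ^ (k + 1) - 3 * r ^ k := by
    rw [zpow_add_one₀ hr, zpow_add_one₀ hr]
    linear_combination r ^ k * hr'
  simp only [t, sub_add_cancel]
  rw [hzpow hp (by linear_combination hs / 4), hzpow hq (by linear_combination hs / 4)]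
  ring

theorem continuationsFactor_two_mul (n : ℕ) :
    ContinuationsFactor (2 * n) (t n) (t n - 3 * t ((n : ℤ) - 1)) (t n)
      (t n - t ((n : ℤ) - 1)) := by
  induction n with
  | zero => simpa [t_zero, t_neg_one] using continuationsFactor_zero
  | succ n ih =>
    have h := ih.succ.succ
    convert h using 1 <;> push_cast <;> (try rw [t_add_one]) <;> ring_nf

theorem M_three_even_odd (n : ℕ) :
    (M 3 (2 * n) : ℝ) = t n ^ 2 ∧
    (M 3 (2 * n + 1) : ℝ) =
      (4 * t n - 3 * t ((n : ℤ) - 1)) * (2 * t n - 3 * t ((n : ℤ) - 1)) := by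
  have h := continuationsFactor_two_mul n
  rw [h.M_eq, h.succ.M_eq]
  constructor <;> ring
end

section
/- Let a_n = B_{3,n} and b_n = W_{3,n} be the numbers of placements of mutually nonattacking pawns on the black squares and on the white squares of a 3×n chessboard, respectively. Then in the ring of formal power series ℚ[[x]], (1 − 5x² + 3x⁴)·(∑_{n≥0} a_n xⁿ) = 1 + 4x − 3x³ and (1 − 5x² + 3x⁴)·(∑_{n≥0} b_n xⁿ) = 1 + 2x − 3x³. -/
/-- No cell of a column `s` is diagonally adjacent to a cell of the neighbouring column `t`. -/
def ColCompat (s t : Finset (Fin 3)) : Prop :=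
  ∀ i ∈ s, ∀ k ∈ t, ¬ |(i : ℤ) - (k : ℤ)| = 1

instance (s t : Finset (Fin 3)) : Decidable (ColCompat s t) := by
  unfold ColCompat; infer_instance

/-- The columns `f` carry cells of colour `c` only, neighbouring columns are compatible, and the
first one is compatible with a preceding column `prev`. -/
def ColGood (c : ℕ) {n : ℕ} (prev : Finset (Fin 3)) (f : Fin n → Finset (Fin 3)) : Prop :=
  ∀ j : Fin n, (∀ i ∈ f j, Even ((i : ℕ) + (j : ℕ) + c)) ∧
    ColCompat ((Fin.cons prev f : Fin (n + 1) → Finset (Fin 3)) j.castSucc) (f j)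

/-- The number of placements on `n` columns following a column `prev`. -/
noncomputable def colCount (c n : ℕ) (prev : Finset (Fin 3)) : ℕ :=
  Nat.card {f : Fin n → Finset (Fin 3) // ColGood c prev f}

theorem colGood_cons {c n : ℕ} {prev s : Finset (Fin 3)} {f : Fin n → Finset (Fin 3)} :
    ColGood c prev (Fin.cons s f : Fin (n + 1) → Finset (Fin 3)) ↔
      ((∀ i ∈ s, Even ((i : ℕ) + c)) ∧ ColCompat prev s) ∧ ColGood (c + 1) s f := by
  unfold ColGood
  rw [Fin.forall_fin_succ]
  refine and_congr (by simp) (forall_congr' fun j => ?_)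
  rw [← Fin.succ_castSucc]
  simp only [Fin.cons_succ, Fin.val_succ, add_assoc, add_comm c 1]

theorem colCount_zero (c : ℕ) (prev : Finset (Fin 3)) : colCount c 0 prev = 1 := by
  have : Unique {f : Fin 0 → Finset (Fin 3) // ColGood c prev f} :=
    ⟨⟨⟨Fin.elim0, fun j => j.elim0⟩⟩, fun _ => Subsingleton.elim _ _⟩
  exact Nat.card_unique

theorem colCount_succ (c n : ℕ) (prev : Finset (Fin 3)) :
    colCount c (n + 1) prev =
      ∑ s with (∀ i : Fin 3, i ∈ s → Even ((i : ℕ) + c)) ∧ ColCompat prev s,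
        colCount (c + 1) n s := by
  let e : {f : Fin (n + 1) → Finset (Fin 3) // ColGood c prev f} ≃
      (Σ s : {s : Finset (Fin 3) // (∀ i ∈ s, Even ((i : ℕ) + c)) ∧ ColCompat prev s},
        {f : Fin n → Finset (Fin 3) // ColGood (c + 1) s.1 f}) :=
    { toFun := fun f =>
        have h := colGood_cons.1 ((Fin.cons_self_tail f.1).symm ▸ f.2)
        ⟨⟨f.1 0, h.1⟩, ⟨Fin.tail f.1, h.2⟩⟩
      invFun := fun p => ⟨Fin.cons p.1.1 p.2.1, colGood_cons.2 ⟨p.1.2, p.2.2⟩⟩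
      left_inv := fun f => Subtype.ext (Fin.cons_self_tail f.1)
      right_inv := fun p => rfl }
  rw [colCount, Nat.card_congr e, Nat.card_sigma]
  exact (Finset.sum_subtype _ (by simp) (colCount (c + 1) n)).symm

theorem colCount_add_two (c n : ℕ) (prev : Finset (Fin 3)) :
    colCount (c + 2) n prev = colCount c n prev := by
  have h (a : ℕ) : Even (a + (c + 2)) ↔ Even (a + c) := by grind
  simp only [colCount, ColGood, h]

theorem colCount_even_empty (n : ℕ) :
    colCount 0 (n + 1) ∅ = colCount 1 n ∅ + 3 * colCount 1 n {0} := by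
  have h : ∀ s : Finset (Fin 3), s ∈ ({{0}, {2}, {0, 2}} : Finset (Finset (Fin 3))) →
      colCount 1 n s = colCount 1 n {0} := by
    intro s hs
    cases n with
    | zero => simp only [colCount_zero]
    | succ n =>
      rw [colCount_succ, colCount_succ]
      refine Finset.sum_congr ?_ fun _ _ => rfl
      revert s
      decide
  rw [colCount_succ, show (Finset.univ.filter fun s : Finset (Fin 3) =>
    (∀ i ∈ s, Even ((i : ℕ) + 0)) ∧ ColCompat ∅ s) = insert ∅ {{0}, {2}, {0, 2}} by decide,
    Finset.sum_insert (by decide), Finset.sum_congr rfl h, Finset.sum_const]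
  rfl

theorem colCount_even_middle (n : ℕ) : colCount 0 (n + 1) {1} = colCount 1 n ∅ := by
  rw [colCount_succ, show (Finset.univ.filter fun s : Finset (Fin 3) =>
    (∀ i ∈ s, Even ((i : ℕ) + 0)) ∧ ColCompat {1} s) = {∅} by decide, Finset.sum_singleton]

theorem colCount_odd_empty (n : ℕ) :
    colCount 1 (n + 1) ∅ = colCount 0 n ∅ + colCount 0 n {1} := by
  rw [colCount_succ, show (Finset.univ.filter fun s : Finset (Fin 3) =>
    (∀ i ∈ s, Even ((i : ℕ) + 1)) ∧ ColCompat ∅ s) = {∅, {1}} by decide,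
    Finset.sum_pair (by decide), colCount_add_two 0, colCount_add_two 0]

theorem colCount_odd_corner (n : ℕ) : colCount 1 (n + 1) {0} = colCount 0 n ∅ := by
  rw [colCount_succ, show (Finset.univ.filter fun s : Finset (Fin 3) =>
    (∀ i ∈ s, Even ((i : ℕ) + 1)) ∧ ColCompat {0} s) = {∅} by decide,
    Finset.sum_singleton, colCount_add_two 0]

theorem colGood_empty_iff {c n : ℕ} {f : Fin n → Finset (Fin 3)} :
    ColGood c ∅ f ↔ (∀ j, ∀ i ∈ f j, Even ((i : ℕ) + (j : ℕ) + c)) ∧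
      ∀ j k : Fin n, (j : ℕ) + 1 = k → ColCompat (f j) (f k) := by
  rw [ColGood, forall_and]
  refine and_congr_right fun _ => ?_
  cases n with
  | zero => simp
  | succ n =>
    constructor
    · intro h j k hjk
      obtain ⟨k, rfl⟩ := Fin.exists_succ_eq.2 (show k ≠ 0 by rintro rfl; simp at hjk)
      have := h k.succ
      rw [← Fin.succ_castSucc, Fin.cons_succ] at this
      rwa [show j = k.castSucc from Fin.ext (by simpa using hjk)]
    · intro h j
      refine Fin.cases ?_ (fun k => ?_) j
      · simp [ColCompat]
      · rw [← Fin.succ_castSucc, Fin.cons_succ]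
        exact h _ _ (by simp)

/-- A set of cells of a board, seen as the family of its columns. -/
def columnsEquiv (m n : ℕ) : Finset (Fin m × Fin n) ≃ (Fin n → Finset (Fin m)) where
  toFun S j := {i | (i, j) ∈ S}
  invFun f := {p | p.1 ∈ f p.2}
  left_inv S := by ext; simp
  right_inv f := by ext; simp

theorem card_nonattacking_eq_colCount (c n : ℕ) :
    Nat.card {S : Finset (Fin 3 × Fin n) // (∀ p ∈ S, Even ((p.1 : ℕ) + (p.2 : ℕ) + c)) ∧
      ∀ p ∈ S, ∀ q ∈ S, ¬ diagAdj p q} = colCount c n ∅ := by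
  refine Nat.card_congr ((columnsEquiv 3 n).subtypeEquiv fun S => ?_)
  rw [colGood_empty_iff]
  simp only [columnsEquiv, Equiv.coe_fn_mk, Finset.mem_filter, Finset.mem_univ, true_and,
    ColCompat, diagAdj]
  refine and_congr ⟨fun h j i hi => h _ hi, fun h p hp => h _ _ hp⟩ ⟨?_, ?_⟩
  · intro h j k hjk i hi l hl hil
    refine h _ hi _ hl ⟨hil, ?_⟩
    rw [abs_eq one_pos.le]
    dsimp only
    omega
  · rintro h ⟨i, j⟩ hp ⟨l, k⟩ hq ⟨h1, h2⟩
    dsimp only at h1 h2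
    rcases (abs_eq one_pos.le).1 h2 with h2 | h2
    · exact h k j (by omega) l hq i hp (by rwa [abs_sub_comm])
    · exact h j k (by omega) i hp l hq h1

theorem B_three_eq_colCount (n : ℕ) : B 3 n = colCount 0 n ∅ :=
  card_nonattacking_eq_colCount 0 n

theorem W_three_eq_colCount (n : ℕ) : W 3 n = colCount 1 n ∅ := by
  rw [← card_nonattacking_eq_colCount 1 n, W]
  simp only [Nat.even_add_one, Nat.not_even_iff_odd]

open PowerSeries in
/-- A sequence satisfying `u (n + 4) + 3 u n = 5 u (n + 2)` has the expected generating function. -/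
theorem mul_mk_eq_of_recurrence (u : ℕ → ℚ) (h : ∀ n, u (n + 4) + 3 * u n = 5 * u (n + 2)) :
    (1 - 5 * (X : ℚ⟦X⟧) ^ 2 + 3 * X ^ 4) * PowerSeries.mk u =
      C (u 0) + C (u 1) * X + C (u 2 - 5 * u 0) * X ^ 2 + C (u 3 - 5 * u 1) * X ^ 3 := by
  have e : (1 - 5 * (X : ℚ⟦X⟧) ^ 2 + 3 * X ^ 4) * PowerSeries.mk u =
      PowerSeries.mk u - C 5 * (X ^ 2 * PowerSeries.mk u) +
        C 3 * (X ^ 4 * PowerSeries.mk u) := by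
    rw [map_ofNat, map_ofNat]
    ring
  rw [e]
  ext n
  simp only [map_add (coeff n), map_sub (coeff n), coeff_C_mul, coeff_X_pow_mul', coeff_mk,
    coeff_C, coeff_X,
    coeff_X_pow]
  match n with
  | 0 | 1 | 2 | 3 => simp
  | n + 4 =>
    have := h n
    simp
    linarith

open PowerSeries in
theorem gf_three_black_white :
    (1 - 5 * (X : ℚ⟦X⟧) ^ 2 + 3 * X ^ 4) * PowerSeries.mk (fun n => (B 3 n : ℚ)) =
      1 + 4 * X - 3 * X ^ 3 ∧
    (1 - 5 * (X : ℚ⟦X⟧) ^ 2 + 3 * X ^ 4) * PowerSeries.mk (fun n => (W 3 n : ℚ)) =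
      1 + 2 * X - 3 * X ^ 3 := by
  simp only [B_three_eq_colCount, W_three_eq_colCount]
  constructor
  · rw [mul_mk_eq_of_recurrence]
    · simp only [colCount_even_empty, colCount_even_middle, colCount_odd_empty,
        colCount_odd_corner, colCount_zero]
      norm_num
      simp only [map_ofNat]
      ring
    · intro n
      simp only [colCount_even_empty, colCount_even_middle, colCount_odd_empty,
        colCount_odd_corner]
      push_cast
      ring
  · rw [mul_mk_eq_of_recurrence]
    · simp only [colCount_even_empty, colCount_even_middle, colCount_odd_empty,
        colCount_odd_corner, colCount_zero]
      norm_num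
      simp only [map_ofNat]
      ring
    · intro n
      simp only [colCount_even_empty, colCount_even_middle, colCount_odd_empty,
        colCount_odd_corner]
      push_cast
      ring
end

section
/- Let (α_n)_{n≥0} be the integer sequence defined by α_0 = 1, α_1 = 8, α_2 = 21, α_3 = 95, α_4 = 324 and α_n = 3α_{n−1} + 6α_{n−2} − 11α_{n−3} − 5α_{n−4} + 6α_{n−5} for n ≥ 5 (equivalently, the sequence with ordinary generating function (1+5x−9x²−5x³+6x⁴)/(1−3x−6x²+11x³+5x⁴−6x⁵)). Then for every natural number n, M_{6,n} = α_n². -/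
/-- Columns `x` and `y` of one colour class, read in opposite vertical directions, carry no
diagonally adjacent 1's. -/
def Compat (x y : Fin 3 → Bool) : Prop :=
  ∀ i k : Fin 3, (i : ℕ) + k = 2 ∨ (i : ℕ) + k = 3 → ¬ (x i = true ∧ y k = true)

instance (x y : Fin 3 → Bool) : Decidable (Compat x y) := by
  unfold Compat; infer_instance

/-- Consecutive columns of `f` are compatible. -/
def IsCompatChain {n : ℕ} (f : Fin n → Fin 3 → Bool) : Prop :=
  ∀ j (h : j + 1 < n), Compat (f ⟨j, by omega⟩) (f ⟨j + 1, h⟩)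

noncomputable instance {n : ℕ} : DecidablePred (@IsCompatChain n) := fun _ => Classical.dec _

/-- The number of chains of `n` columns that can be appended after the column `s`. -/
def chainCount : ℕ → (Fin 3 → Bool) → ℤ
  | 0, _ => 1
  | n + 1, s => ∑ t, if Compat s t then chainCount n t else 0

lemma chainCount_zero (s : Fin 3 → Bool) : chainCount 0 s = 1 := rfl

lemma isCompatChain_cons_cons {n : ℕ} (s t : Fin 3 → Bool) (f : Fin n → Fin 3 → Bool) :
    IsCompatChain (Fin.cons s (Fin.cons t f : Fin (n + 1) → Fin 3 → Bool) :
      Fin (n + 2) → Fin 3 → Bool) ↔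
    Compat s t ∧ IsCompatChain (Fin.cons t f : Fin (n + 1) → Fin 3 → Bool) := by
  constructor
  · intro h
    have h₀ : Compat s t := h 0 (Nat.succ_lt_succ n.succ_pos)
    exact ⟨h₀, fun j hj => h (j + 1) (by omega)⟩
  · rintro ⟨h, h'⟩ (_ | j) hj
    · exact h
    · exact h' j (by omega)

lemma isCompatChain_cons_false {n : ℕ} (f : Fin n → Fin 3 → Bool) :
    IsCompatChain (Fin.cons (fun _ => false) f : Fin (n + 1) → Fin 3 → Bool) ↔
      IsCompatChain f := by
  constructor
  · exact fun h j hj => h (j + 1) (by omega)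
  · rintro h (_ | j) hj
    · exact fun i k _ hik => Bool.false_ne_true hik.1
    · exact h j (by omega)

lemma sum_isCompatChain_cons (n : ℕ) (s : Fin 3 → Bool) :
    (∑ f : Fin n → Fin 3 → Bool,
      if IsCompatChain (Fin.cons s f : Fin (n + 1) → Fin 3 → Bool) then (1 : ℤ) else 0) =
      chainCount n s := by
  induction n generalizing s with
  | zero =>
    have h (f : Fin 0 → Fin 3 → Bool) :
        IsCompatChain (Fin.cons s f : Fin 1 → Fin 3 → Bool) := fun j hj => by omega
    simp [h, chainCount]
  | succ n ih =>
    rw [← (Fin.consEquiv fun _ : Fin (n + 1) => Fin 3 → Bool).sum_comp, Fintype.sum_prod_type,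
      chainCount]
    refine Finset.sum_congr rfl fun t _ => ?_
    simp only [Fin.consEquiv, Equiv.coe_fn_mk, isCompatChain_cons_cons, ite_and]
    split_ifs
    · exact ih t
    · simp

lemma card_isCompatChain (n : ℕ) :
    (Nat.card {f : Fin n → Fin 3 → Bool // IsCompatChain f} : ℤ) =
      chainCount n (fun _ => false) := by
  rw [← sum_isCompatChain_cons]
  simp only [isCompatChain_cons_false]
  rw [Nat.card_eq_fintype_card, Fintype.card_subtype, Finset.sum_boole]

/-- The cells of a board with six rows, sorted by colour, column, and position in the column;
columns of opposite parity are read in opposite vertical directions. -/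
def colourEquiv (n : ℕ) : Fin 2 × Fin n × Fin 3 ≃ Fin 6 × Fin n where
  toFun p := (⟨if (p.1 + p.2.1 : ℕ) % 2 = 0 then 2 * p.2.2 else 5 - 2 * p.2.2,
    by split_ifs <;> omega⟩, p.2.1)
  invFun q := (⟨(q.1 + q.2 : ℕ) % 2, by omega⟩, q.2,
    ⟨if (q.1 : ℕ) % 2 = 0 then q.1 / 2 else (5 - q.1) / 2, by split_ifs <;> omega⟩)
  left_inv := by
    rintro ⟨b, j, k⟩
    simp only [Prod.mk.injEq, Fin.ext_iff, true_and]
    constructor <;> split_ifs <;> omega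
  right_inv := by
    rintro ⟨i, j⟩
    simp only [Prod.mk.injEq, Fin.ext_iff, and_true]
    split_ifs <;> omega

/-- Splitting a board with six rows into its two colour classes. -/
def splitEquiv (n : ℕ) : (Fin 6 × Fin n → Bool) ≃ (Fin 2 → Fin n → Fin 3 → Bool) :=
  ((colourEquiv n).symm.arrowCongr (Equiv.refl Bool)).trans
    ((Equiv.curry _ _ _).trans ((Equiv.refl (Fin 2)).arrowCongr (Equiv.curry _ _ _)))

lemma splitEquiv_apply {n : ℕ} (A : Fin 6 × Fin n → Bool) (b : Fin 2) (j : Fin n) (k : Fin 3) :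
    splitEquiv n A b j k = A (colourEquiv n (b, j, k)) := rfl

lemma not_hasAnti_and_not_hasMain_iff {m n : ℕ} (A : Fin m × Fin n → Bool) :
    (¬ hasAnti m n A ∧ ¬ hasMain m n A) ↔
      ∀ (j : ℕ) (hj : j + 1 < n) (i i' : Fin m), (i : ℕ) + 1 = i' ∨ (i' : ℕ) + 1 = i →
        ¬ (A (i, ⟨j, by omega⟩) = true ∧ A (i', ⟨j + 1, hj⟩) = true) := by
  constructor
  · rintro ⟨h, h'⟩ j hj ⟨i, hi⟩ ⟨i', hi'⟩ (rfl | rfl) hA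
    · exact h' ⟨i, j, hi', hj, hA⟩
    · exact h ⟨i', j, hi, hj, hA⟩
  · intro h
    constructor
    · rintro ⟨i, j, hi, hj, hA⟩
      exact h j hj _ _ (Or.inr rfl) hA
    · rintro ⟨i, j, hi, hj, hA⟩
      exact h j hj _ _ (Or.inl rfl) hA

lemma not_hasAnti_and_not_hasMain_iff_isCompatChain {n : ℕ} (A : Fin 6 × Fin n → Bool) :
    (¬ hasAnti 6 n A ∧ ¬ hasMain 6 n A) ↔ ∀ b, IsCompatChain (splitEquiv n A b) := by
  rw [not_hasAnti_and_not_hasMain_iff]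
  constructor
  · intro h b j hj k k' hk
    refine h j hj _ _ ?_
    simp only
    split_ifs <;> omega
  · intro h j hj i i' hi hA
    have hb : ((colourEquiv n).symm (i', ⟨j + 1, hj⟩)).1 =
        ((colourEquiv n).symm (i, ⟨j, by omega⟩)).1 := by
      simp only [colourEquiv, Equiv.coe_fn_symm_mk, Fin.ext_iff]
      omega
    refine h ((colourEquiv n).symm (i, ⟨j, by omega⟩)).1 j hj
      ((colourEquiv n).symm (i, ⟨j, by omega⟩)).2.2
      ((colourEquiv n).symm (i', ⟨j + 1, hj⟩)).2.2 ?_ ⟨?_, ?_⟩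
    · simp only [colourEquiv, Equiv.coe_fn_symm_mk]
      split_ifs <;> omega
    · rw [splitEquiv_apply]
      exact (congrArg A ((colourEquiv n).apply_symm_apply _)).trans hA.1
    · rw [splitEquiv_apply, ← hb]
      exact (congrArg A ((colourEquiv n).apply_symm_apply _)).trans hA.2

lemma M_six_eq_chainCount_sq (n : ℕ) : (M 6 n : ℤ) = chainCount n (fun _ => false) ^ 2 := by
  rw [M, ← card_isCompatChain, Nat.card_congr (((splitEquiv n).subtypeEquiv
    not_hasAnti_and_not_hasMain_iff_isCompatChain).trans Equiv.subtypePiEquivPi), Nat.card_pi]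
  simp

lemma sum_boolTriple (F : (Fin 3 → Bool) → ℤ) :
    ∑ t, F t = F ![false, false, false] + F ![true, false, false] + F ![false, true, false] +
      F ![true, true, false] + F ![false, false, true] + F ![true, false, true] +
      F ![false, true, true] + F ![true, true, true] := by
  have h : (Finset.univ : Finset (Fin 3 → Bool)) =
      {![false, false, false], ![true, false, false], ![false, true, false],
        ![true, true, false], ![false, false, true], ![true, false, true],
        ![false, true, true], ![true, true, true]} := by decide
  rw [h]
  repeat rw [Finset.sum_insert (by decide)]
  rw [Finset.sum_singleton]
  ring

lemma chainCount_congr {s s' : Fin 3 → Bool} (h : ∀ t, Compat s t ↔ Compat s' t) (n : ℕ) :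
    chainCount n s = chainCount n s' := by
  cases n <;> simp only [chainCount, h]

lemma chainCount_succ_eqs (n : ℕ) :
    chainCount (n + 1) ![false, false, false] = chainCount n ![false, false, false] +
      chainCount n ![true, false, false] + 2 * chainCount n ![false, true, false] +
      chainCount n ![false, false, true] + 3 * chainCount n ![true, true, true] ∧
    chainCount (n + 1) ![true, false, false] = chainCount n ![false, false, false] +
      chainCount n ![true, false, false] + 2 * chainCount n ![false, true, false] ∧
    chainCount (n + 1) ![false, true, false] = chainCount n ![false, false, false] +
      chainCount n ![true, false, false] ∧
    chainCount (n + 1) ![false, false, true] = chainCount n ![false, false, false] +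
      chainCount n ![false, false, true] ∧
    chainCount (n + 1) ![true, true, true] = chainCount n ![false, false, false] := by
  have h₁ : chainCount n ![true, true, false] = chainCount n ![false, true, false] :=
    chainCount_congr (by decide) n
  have h₂ : chainCount n ![true, false, true] = chainCount n ![true, true, true] :=
    chainCount_congr (by decide) n
  have h₃ : chainCount n ![false, true, true] = chainCount n ![true, true, true] :=
    chainCount_congr (by decide) n
  simp only [chainCount, sum_boolTriple, h₁, h₂, h₃]
  refine ⟨?_, ?_, ?_, ?_, ?_⟩ <;>
    simp +decide only [if_true, if_false] <;> ring

lemma chainCount_recurrence (n : ℕ) :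
    chainCount (n + 5) ![false, false, false] =
      3 * chainCount (n + 4) ![false, false, false] +
      6 * chainCount (n + 3) ![false, false, false] -
      11 * chainCount (n + 2) ![false, false, false] -
      5 * chainCount (n + 1) ![false, false, false] +
      6 * chainCount n ![false, false, false] := by
  simp only [chainCount_succ_eqs]
  ring

theorem M_six_formula (α : ℕ → ℤ) (h0 : α 0 = 1) (h1 : α 1 = 8) (h2 : α 2 = 21)
    (h3 : α 3 = 95) (h4 : α 4 = 324)
    (hrec : ∀ n, α (n + 5) =
      3 * α (n + 4) + 6 * α (n + 3) - 11 * α (n + 2) - 5 * α (n + 1) + 6 * α n) :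
    ∀ n : ℕ, (M 6 n : ℤ) = α n ^ 2 := by
  have key (n : ℕ) : α n = chainCount n ![false, false, false] := by
    induction n using Nat.strong_induction_on with
    | _ n ih =>
      match n with
      | 0 => simpa [chainCount_zero] using h0
      | 1 =>
        simp [h1, chainCount_zero, chainCount_succ_eqs 0]
      | 2 =>
        simp [h2, chainCount_zero, chainCount_succ_eqs 0, chainCount_succ_eqs 1]
      | 3 =>
        simp [h3, chainCount_zero, chainCount_succ_eqs 0, chainCount_succ_eqs 1,
          chainCount_succ_eqs 2]
      | 4 =>
        simp [h4, chainCount_zero, chainCount_succ_eqs 0, chainCount_succ_eqs 1,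
          chainCount_succ_eqs 2, chainCount_succ_eqs 3]
      | n + 5 =>
        rw [hrec, chainCount_recurrence, ih n (by omega), ih (n + 1) (by omega),
          ih (n + 2) (by omega), ih (n + 3) (by omega), ih (n + 4) (by omega)]
  have hzero : (fun _ => false : Fin 3 → Bool) = ![false, false, false] := by decide
  intro n
  rw [M_six_eq_chainCount_sq, key, hzero]
end
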